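/- arXiv:0905.0287 — 5 statements merged into one kernel-verified Lean document; each statement's English description precedes it below -/
import Mathlib

section
/- (Non-Abelian fiberwise Stokes/homotopy formula, 1-form case over a one-dimensional base.) Let A be a real unital Banach algebra, let ω₀, ω₁ : ℝ × ℝ → A be C¹, and let g : ℝ × ℝ → A be C² with g(x,0) = 1, every g(x,t) invertible, and ∂_t g(x,t) = −ω₁(x,t)·g(x,t) for all (x,t). Define the curvature component Ω(x,t) = ∂_t ω₀(x,t) − ∂_x ω₁(x,t) + ω₁(x,t)·ω₀(x,t) − ω₀(x,t)·ω₁(x,t). Then for every x, writing g₁ = g(x,1): −∂_x g(x,1) · g₁⁻¹ + ∫₀¹ g₁ · g(x,t)⁻¹ · Ω(x,t) · g(x,t) · g₁⁻¹ dt = ω₀(x,1) − g₁ · ω₀(x,0) · g₁⁻¹. -/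
/-- Derivative of the inverse along a curve of units. -/
theorem HasDerivAt.ringInverse_of_isUnit {A : Type*} [NormedRing A] [NormedAlgebra ℝ A]
    [CompleteSpace A] {f : ℝ → A} {f' : A} {t : ℝ} (hf : HasDerivAt f f' t) (hu : IsUnit (f t)) :
    HasDerivAt (fun s => Ring.inverse (f s))
      (-(Ring.inverse (f t) * f' * Ring.inverse (f t))) t := by
  obtain ⟨u, hu⟩ := hu
  have h := hasFDerivAt_ringInverse (𝕜 := ℝ) u
  rw [hu] at h
  have h' := h.comp_hasDerivAt t hf
  simpa [← hu, Function.comp_def] using h'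

section PartialDerivatives

variable {E : Type*} [NormedAddCommGroup E] [NormedSpace ℝ E] {f : ℝ × ℝ → E}

theorem DifferentiableAt.hasDerivAt_partial_fst {x t : ℝ} (hf : DifferentiableAt ℝ f (x, t)) :
    HasDerivAt (fun u => f (u, t)) (fderiv ℝ f (x, t) (1, 0)) x :=
  hf.hasFDerivAt.comp_hasDerivAt x ((hasDerivAt_id x).prodMk (hasDerivAt_const x t))

theorem DifferentiableAt.hasDerivAt_partial_snd {x t : ℝ} (hf : DifferentiableAt ℝ f (x, t)) :
    HasDerivAt (fun s => f (x, s)) (fderiv ℝ f (x, t) (0, 1)) t :=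
  hf.hasFDerivAt.comp_hasDerivAt t ((hasDerivAt_const t x).prodMk (hasDerivAt_id t))

/-- Equality of mixed partial derivatives: `∂_t ∂_x f = ∂_x ∂_t f` for `f` of class `C²`. -/
theorem ContDiff.hasDerivAt_partial_snd_partial_fst (hf : ContDiff ℝ 2 f) {x t : ℝ} {e : E}
    (he : HasDerivAt (fun u => deriv (fun s => f (u, s)) t) e x) :
    HasDerivAt (fun s => deriv (fun u => f (u, s)) x) e t := by
  have hd : Differentiable ℝ f := hf.differentiable (by norm_num)
  have hd' : Differentiable ℝ (fderiv ℝ f) :=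
    (hf.fderiv_right (m := 1) (by norm_num)).differentiable (by norm_num)
  have hsymm : IsSymmSndFDerivAt ℝ f (x, t) :=
    hf.contDiffAt.isSymmSndFDerivAt (by simp)
  have hfst (u s : ℝ) : deriv (fun v => f (v, s)) u = fderiv ℝ f (u, s) (1, 0) :=
    (hd _).hasDerivAt_partial_fst.deriv
  have hsnd (u s : ℝ) : deriv (fun v => f (u, v)) s = fderiv ℝ f (u, s) (0, 1) :=
    (hd _).hasDerivAt_partial_snd.deriv
  simp only [hfst, hsnd] at he ⊢
  have h₁ := (hd' (x, t)).hasDerivAt_partial_fst.clm_apply (hasDerivAt_const x ((0, 1) : ℝ × ℝ))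
  have h₂ := (hd' (x, t)).hasDerivAt_partial_snd.clm_apply (hasDerivAt_const t ((1, 0) : ℝ × ℝ))
  simp only [map_zero, add_zero] at h₁ h₂
  rw [he.unique h₁, ← hsymm.eq]
  exact h₂

theorem ContDiff.continuous_partial_fst (hf : ContDiff ℝ 1 f) :
    Continuous fun p : ℝ × ℝ => deriv (fun u => f (u, p.2)) p.1 := by
  have h (p : ℝ × ℝ) : deriv (fun u => f (u, p.2)) p.1 = fderiv ℝ f p (1, 0) :=
    (hf.differentiable (by norm_num) _).hasDerivAt_partial_fst.deriv
  simp only [h]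
  exact (hf.continuous_fderiv (by norm_num)).clm_apply continuous_const

theorem ContDiff.continuous_partial_snd (hf : ContDiff ℝ 1 f) :
    Continuous fun p : ℝ × ℝ => deriv (fun s => f (p.1, s)) p.2 := by
  have h (p : ℝ × ℝ) : deriv (fun s => f (p.1, s)) p.2 = fderiv ℝ f p (0, 1) :=
    (hf.differentiable (by norm_num) _).hasDerivAt_partial_snd.deriv
  simp only [h]
  exact (hf.continuous_fderiv (by norm_num)).clm_apply continuous_const

end PartialDerivatives


/-- **Non-Abelian fiberwise Stokes / homotopy formula** (1-form case over a
one-dimensional base).  For `ω = ω₀ dx + ω₁ dt` on `ℝ × [0,1]` and the multiplicative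
integral `g` of `-ω₁` along the fibers, with curvature component
`Ω(x,t) = ∂_t ω₀ - ∂_x ω₁ + ω₁ ω₀ - ω₀ ω₁`, writing `g₁ = g(x,1)`:
`-∂_x g(x,1) · g₁⁻¹ + ∫₀¹ g₁ g(x,t)⁻¹ Ω(x,t) g(x,t) g₁⁻¹ dt = ω₀(x,1) - g₁ ω₀(x,0) g₁⁻¹`. -/
theorem nonabelian_fiberwise_stokes
    {A : Type*} [NormedRing A] [NormedAlgebra ℝ A] [CompleteSpace A]
    (ω₀ ω₁ g : ℝ × ℝ → A)
    (hω₀ : ContDiff ℝ 1 ω₀) (hω₁ : ContDiff ℝ 1 ω₁) (hg : ContDiff ℝ 2 g)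
    (hg0 : ∀ x : ℝ, g (x, 0) = 1)
    (hgu : ∀ p : ℝ × ℝ, IsUnit (g p))
    (hgt : ∀ x t : ℝ, deriv (fun s => g (x, s)) t = -(ω₁ (x, t)) * g (x, t)) :
    ∀ x : ℝ,
      -(deriv (fun u => g (u, 1)) x) * Ring.inverse (g (x, 1)) +
        (∫ t in (0:ℝ)..1,
          g (x, 1) * Ring.inverse (g (x, t)) *
            (deriv (fun s => ω₀ (x, s)) t - deriv (fun u => ω₁ (u, t)) x
              + ω₁ (x, t) * ω₀ (x, t) - ω₀ (x, t) * ω₁ (x, t)) *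
            g (x, t) * Ring.inverse (g (x, 1)))
      = ω₀ (x, 1) - g (x, 1) * ω₀ (x, 0) * Ring.inverse (g (x, 1)) := by
  intro x
  have dω₀ : Differentiable ℝ ω₀ := hω₀.differentiable (by norm_num)
  have dω₁ : Differentiable ℝ ω₁ := hω₁.differentiable (by norm_num)
  have dg : Differentiable ℝ g := hg.differentiable (by norm_num)
  have hgs (t : ℝ) : HasDerivAt (fun s => g (x, s)) (-(ω₁ (x, t)) * g (x, t)) t := by
    rw [← hgt]
    exact (dg _).hasDerivAt_partial_snd.differentiableAt.hasDerivAt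
  have hgx (t : ℝ) : HasDerivAt (fun u => g (u, t)) (deriv (fun u => g (u, t)) x) x :=
    (dg _).hasDerivAt_partial_fst.differentiableAt.hasDerivAt
  have hω₀t (t : ℝ) : HasDerivAt (fun s => ω₀ (x, s)) (deriv (fun s => ω₀ (x, s)) t) t :=
    (dω₀ _).hasDerivAt_partial_snd.differentiableAt.hasDerivAt
  have hω₁x (t : ℝ) : HasDerivAt (fun u => ω₁ (u, t)) (deriv (fun u => ω₁ (u, t)) x) x :=
    (dω₁ _).hasDerivAt_partial_fst.differentiableAt.hasDerivAt
  have hgxt (t : ℝ) : HasDerivAt (fun s => deriv (fun u => g (u, s)) x)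
      (-(deriv (fun u => ω₁ (u, t)) x) * g (x, t)
        + -(ω₁ (x, t)) * deriv (fun u => g (u, t)) x) t := by
    apply hg.hasDerivAt_partial_snd_partial_fst
    simp only [hgt]
    exact (hω₁x t).neg.mul (hgx t)
  have hinv (t : ℝ) : HasDerivAt (fun s => Ring.inverse (g (x, s)))
      (Ring.inverse (g (x, t)) * ω₁ (x, t)) t := by
    convert (hgs t).ringInverse_of_isUnit (hgu _) using 1
    simp only [neg_mul, mul_neg, neg_neg, mul_assoc, Ring.mul_inverse_cancel _ (hgu _), mul_one]
  have hcinv : Continuous fun t => Ring.inverse (g (x, t)) :=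
    continuous_iff_continuousAt.2 fun t => (hinv t).continuousAt
  have hline : Continuous fun t : ℝ => (x, t) := by fun_prop
  have hcg := hg.continuous.comp hline
  have hcω₀ := hω₀.continuous.comp hline
  have hcω₁ := hω₁.continuous.comp hline
  have hcω₀t := hω₀.continuous_partial_snd.comp hline
  have hcω₁x := hω₁.continuous_partial_fst.comp hline
  simp only [Function.comp_def] at hcg hcω₀ hcω₁ hcω₀t hcω₁x
  have hF (t : ℝ) : HasDerivAt
      (fun s => g (x, 1) * (Ring.inverse (g (x, s)) *
        (ω₀ (x, s) * g (x, s) + deriv (fun u => g (u, s)) x)) * Ring.inverse (g (x, 1)))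
      (g (x, 1) * Ring.inverse (g (x, t)) *
        (deriv (fun s => ω₀ (x, s)) t - deriv (fun u => ω₁ (u, t)) x
          + ω₁ (x, t) * ω₀ (x, t) - ω₀ (x, t) * ω₁ (x, t)) *
        g (x, t) * Ring.inverse (g (x, 1))) t := by
    convert (((hinv t).fun_mul (((hω₀t t).fun_mul (hgs t)).fun_add (hgxt t))).const_mul
      (g (x, 1))).mul_const (Ring.inverse (g (x, 1))) using 1
    noncomm_ring
  have hx0 : deriv (fun u => g (u, 0)) x = 0 := by simp [hg0]
  rw [intervalIntegral.integral_eq_sub_of_hasDerivAt (fun t _ => hF t)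
    (Continuous.intervalIntegrable (by fun_prop) 0 1), hx0, hg0]
  simp only [← mul_assoc, mul_add, add_mul, Ring.mul_inverse_cancel _ (hgu (x, 1)), one_mul,
    Ring.inverse_one, mul_one, add_zero]
  rw [mul_assoc (ω₀ (x, 1)), Ring.mul_inverse_cancel _ (hgu (x, 1))]
  noncomm_ring
end

section
/- (Non-Abelian Poincaré lemma for 1-forms.) Let A be a real unital Banach algebra, let U ⊆ ℝⁿ be an open set that is star-shaped with respect to 0 (i.e. t•x ∈ U whenever x ∈ U and t ∈ [0,1]), and let ω : U → Fin n → A be a smooth family of components ω_i satisfying the Maurer–Cartan (zero-curvature) equation ∂_i ω_j(x) − ∂_j ω_i(x) + ω_i(x)·ω_j(x) − ω_j(x)·ω_i(x) = 0 for all i, j and x ∈ U. Then there exists a smooth map g : U → A with g(0) = 1, g(x) invertible for every x ∈ U, and ω_i(x) = −∂_i g(x) · g(x)⁻¹ for all i and x ∈ U. -/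
open Set Filter Topology

/-- A linear ODE `h' = L h` in a Banach space, with continuous bounded coefficient `L`, has a
global solution with any prescribed value at `0`; it is the sum of the Picard series. -/
theorem exists_forall_hasDerivAt_clm_apply {E : Type*} [NormedAddCommGroup E] [NormedSpace ℝ E]
    [CompleteSpace E] {L : ℝ → E →L[ℝ] E} (hL : Continuous L) {M : ℝ} (hM : ∀ t, ‖L t‖ ≤ M)
    (x₀ : E) : ∃ h : ℝ → E, h 0 = x₀ ∧ ∀ t, HasDerivAt h (L t (h t)) t := by
  have hM0 : 0 ≤ M := (norm_nonneg _).trans (hM 0)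
  let p : ℕ → ℝ → E := fun n => Nat.rec (fun _ => x₀) (fun _ f t => ∫ s in (0:ℝ)..t, L s (f s)) n
  have p_succ (n : ℕ) (t : ℝ) : p (n + 1) t = ∫ s in (0:ℝ)..t, L s (p n s) := rfl
  have hc : ∀ n, Continuous (p n) := by
    intro n
    induction n with
    | zero => exact continuous_const
    | succ n ih =>
      exact intervalIntegral.continuous_primitive
        (fun a b => (hL.clm_apply ih).intervalIntegrable a b) 0
  have hd (n : ℕ) (t : ℝ) : HasDerivAt (p (n + 1)) (L t (p n t)) t :=
    ((hL.clm_apply (hc n)).integral_hasStrictDerivAt 0 t).hasDerivAt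
  have hp : ∀ n t, ‖p n t‖ ≤ (M * |t|) ^ n / n.factorial * ‖x₀‖ := by
    intro n
    induction n with
    | zero => intro t; simp [p]
    | succ n ih =>
      intro t
      rw [p_succ]
      calc _ ≤ ∫ s in uIoc 0 t, ‖L s (p n s)‖ :=
            intervalIntegral.norm_integral_le_integral_norm_uIoc
        _ ≤ ∫ s in uIoc 0 t, M ^ (n + 1) / n.factorial * ‖x₀‖ * |s - 0| ^ n := by
            apply MeasureTheory.setIntegral_mono_on
            · exact (intervalIntegrable_iff.1
                ((hL.clm_apply (hc n)).norm.intervalIntegrable 0 t))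
            · exact (intervalIntegrable_iff.1 (Continuous.intervalIntegrable (by fun_prop) 0 t))
            · exact measurableSet_uIoc
            · intro s _
              refine ((L s).le_of_opNorm_le_of_le (hM s) (ih s)).trans_eq ?_
              rw [sub_zero]
              ring
        _ = _ := by
            rw [MeasureTheory.integral_const_mul, integral_pow_abs_sub_uIoc, sub_zero,
              Nat.factorial_succ, mul_pow]
            push_cast
            field_simp
  have hsum (c : ℝ) : Summable fun n : ℕ => c ^ n / n.factorial * ‖x₀‖ :=
    (Real.summable_pow_div_factorial c).mul_right _
  have hps (t : ℝ) : Summable fun n => p n t := .of_norm_bounded (hsum _) fun n => hp n t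
  refine ⟨fun t => ∑' n, p n t, ?_, fun t => ?_⟩
  · refine (tsum_eq_single 0 fun n hn => ?_).trans rfl
    obtain ⟨m, rfl⟩ := Nat.exists_eq_succ_of_ne_zero hn
    simp [p_succ]
  · have key : HasDerivAt (fun t => ∑' n, p (n + 1) t) (∑' n, L t (p n t)) t := by
      have h0 : (0 : ℝ) ∈ Metric.ball (0 : ℝ) (|t| + 1) := Metric.mem_ball_self (by positivity)
      refine hasDerivAt_tsum_of_isPreconnected
        ((hsum (M * (|t| + 1))).mul_left M) Metric.isOpen_ball
        (convex_ball (0 : ℝ) (|t| + 1)).isPreconnected (fun n y _ => hd n y) (fun n y hy => ?_) h0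
        ((summable_nat_add_iff 1).2 (hps 0)) (by simp)
      refine (L y).le_of_opNorm_le_of_le (hM y) ((hp n y).trans ?_)
      have : |y| ≤ |t| + 1 := by simpa using (mem_ball_zero_iff.1 hy).le
      gcongr
    rw [← (L t).map_tsum (hps t)] at key
    exact (key.const_add x₀).congr_of_eventuallyEq (.of_forall fun s => (hps s).tsum_eq_zero_add)

/-- The linear ODE `h' = B h`, `h 0 = 1` in a Banach algebra has a global solution with invertible
values. -/
theorem exists_isUnit_hasDerivAt_mul {A : Type*} [NormedRing A] [NormedAlgebra ℝ A]
    [CompleteSpace A] {B : ℝ → A} (hB : Continuous B) {M : ℝ} (hM : ∀ t, ‖B t‖ ≤ M) :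
    ∃ h : ℝ → A, h 0 = 1 ∧ (∀ t, HasDerivAt h (B t * h t) t) ∧ ∀ t, IsUnit (h t) := by
  let l := ContinuousLinearMap.mul ℝ A
  have hl (t : ℝ) : ‖l (B t)‖ ≤ M := (ContinuousLinearMap.opNorm_mul_apply_le ℝ A _).trans (hM t)
  have hr (t : ℝ) : ‖l.flip (B t)‖ ≤ M :=
    ContinuousLinearMap.opNorm_le_bound _ ((norm_nonneg _).trans (hM t)) fun a =>
      (norm_mul_le a (B t)).trans (by rw [mul_comm]; gcongr; exact hM t)
  obtain ⟨h, h0, hh⟩ := exists_forall_hasDerivAt_clm_apply (l.continuous.comp hB) hl 1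
  obtain ⟨k, k0, hk⟩ := exists_forall_hasDerivAt_clm_apply (L := fun t => -l.flip (B t))
    (l.flip.continuous.comp hB).neg (fun t => (norm_neg _).trans_le (hr t)) 1
  have hh' (t : ℝ) : HasDerivAt h (B t * h t) t := hh t
  have hk' (t : ℝ) : HasDerivAt k (-(k t * B t)) t := hk t
  have hkh (t : ℝ) : k t * h t = 1 := by
    have hd (s : ℝ) : HasDerivAt (fun s => k s * h s) 0 s := by
      simpa [mul_assoc] using (hk' s).fun_mul (hh' s)
    have := is_const_of_deriv_eq_zero (fun s => (hd s).differentiableAt) (fun s => (hd s).deriv) t 0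
    simpa [h0, k0] using this
  have hhk : (fun t => h t * k t) = fun _ => 1 := by
    refine ODE_solution_unique_univ (v := fun t a => (l (B t) - l.flip (B t)) a)
      (s := fun _ => univ) (K := (M + M).toNNReal) (t₀ := 0) (fun t => ?_) (fun t => ⟨?_, trivial⟩)
      (fun t => ⟨?_, trivial⟩) (by simp [h0, k0])
    · refine ((ContinuousLinearMap.lipschitz _).weaken ?_).lipschitzOnWith
      rw [← NNReal.coe_le_coe, coe_nnnorm]
      exact ((norm_sub_le _ _).trans (add_le_add (hl t) (hr t))).trans (Real.le_coe_toNNReal _)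
    · refine ((hh' t).fun_mul (hk' t)).congr_deriv ?_
      simp [l, mul_assoc, sub_eq_add_neg]
    · simpa [l] using hasDerivAt_const t (1 : A)
  exact ⟨h, h0, hh', fun t => ⟨⟨h t, k t, congrFun hhk t, hkh t⟩, rfl⟩⟩

/-- If the derivative of `F t` at `y` is jointly continuous in `(y, t)`, then the first-order
expansion of `F t` at `x` is uniform for `t` in a compact set. -/
theorem IsCompact.eventually_norm_sub_sub_le {T V W : Type*} [TopologicalSpace T]
    [NormedAddCommGroup V] [NormedSpace ℝ V] [NormedAddCommGroup W] [NormedSpace ℝ W]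
    {K : Set T} (hK : IsCompact K) {F : T → V → W} {P : T → V → V →L[ℝ] W} {x : V}
    (hF : ∀ t ∈ K, ∀ᶠ z : V × T in 𝓝 (x, t), HasFDerivAt (F z.2) (P z.2 z.1) z.1)
    (hP : ∀ t ∈ K, ContinuousAt (fun z : V × T => P z.2 z.1) (x, t)) {ε : ℝ} (hε : 0 < ε) :
    ∀ᶠ y in 𝓝 x, ∀ t ∈ K, ‖F t y - F t x - P t x (y - x)‖ ≤ ε * ‖y - x‖ := by
  have h : ∀ᶠ y in 𝓝 x, ∀ t ∈ K, HasFDerivAt (F t) (P t y) y ∧ ‖P t y - P t x‖ ≤ ε := by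
    refine hK.eventually_forall_of_forall_eventually fun t ht => (hF t ht).and ?_
    have hx : ContinuousAt (fun z : V × T => P z.2 x) (x, t) :=
      ContinuousAt.comp (x := (x, t)) (f := fun z : V × T => (x, z.2)) (hP t ht) (by fun_prop)
    have := ((hP t ht).sub hx).norm
    filter_upwards [this.eventually_lt (continuousAt_const (y := ε)) (by simpa)] with z hz
    exact hz.le
  obtain ⟨r, hr, h⟩ := Metric.eventually_nhds_iff_ball.1 h
  filter_upwards [Metric.ball_mem_nhds x hr] with y hy t ht
  exact (convex_ball x r).norm_image_sub_le_of_norm_hasFDerivWithin_le'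
    (fun z hz => (h z hz t ht).1.hasFDerivWithinAt) (fun z hz => (h z hz t ht).2)
    (Metric.mem_ball_self hr) hy

/-- Differentiability with respect to the parameter `y` of the solutions of `h' = F(t, y) h`: the
derivative at time `1` is the value there of a solution `q` of the variational equation. -/
theorem hasFDerivAt_of_hasDerivAt_mul {A V : Type*} [NormedRing A] [NormedAlgebra ℝ A]
    [NormedAddCommGroup V] [NormedSpace ℝ V] {F : ℝ → V → A} {P : ℝ → V → V →L[ℝ] A} {x : V}
    (hF : ∀ t ∈ Icc (0 : ℝ) 1, ∀ᶠ z : V × ℝ in 𝓝 (x, t), HasFDerivAt (F z.2) (P z.2 z.1) z.1)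
    (hFc : ∀ t ∈ Icc (0 : ℝ) 1, ContinuousAt (fun z : V × ℝ => F z.2 z.1) (x, t))
    (hPc : ∀ t ∈ Icc (0 : ℝ) 1, ContinuousAt (fun z : V × ℝ => P z.2 z.1) (x, t))
    {h : V → ℝ → A} {a : A} (h0 : ∀ᶠ y in 𝓝 x, h y 0 = a)
    (hh : ∀ᶠ y in 𝓝 x, ∀ t ∈ Icc (0 : ℝ) 1, HasDerivAt (h y) (F t y * h y t) t)
    {q : ℝ → V →L[ℝ] A} (hq0 : q 0 = 0) (hqc : ContinuousOn q (Icc 0 1))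
    (hq : ∀ t ∈ Icc (0 : ℝ) 1, ∀ v,
      HasDerivAt (fun s => q s v) (F t x * q t v + P t x v * h x t) t) :
    HasFDerivAt (fun y => h y 1) (q 1) x := by
  have hpair (t : ℝ) : ContinuousAt (fun s : ℝ => (x, s)) t := by fun_prop
  obtain ⟨CF, hCF⟩ := isCompact_Icc.exists_bound_of_continuousOn (f := fun t => F t x)
    fun t ht => (ContinuousAt.comp (x := t) (hFc t ht) (hpair t)).continuousWithinAt
  obtain ⟨CP, hCP⟩ := isCompact_Icc.exists_bound_of_continuousOn (f := fun t => P t x)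
    fun t ht => (ContinuousAt.comp (x := t) (hPc t ht) (hpair t)).continuousWithinAt
  obtain ⟨N, hN⟩ := isCompact_Icc.exists_bound_of_continuousOn (f := h x)
    fun t ht => (hh.self_of_nhds t ht).continuousAt.continuousWithinAt
  obtain ⟨Q, hQ⟩ := isCompact_Icc.exists_bound_of_continuousOn hqc
  have h01 : (0 : ℝ) ∈ Icc (0 : ℝ) 1 := ⟨le_rfl, zero_le_one⟩
  have hCF0 : 0 ≤ CF := (norm_nonneg _).trans (hCF 0 h01)
  have hCP0 : 0 ≤ CP := (norm_nonneg _).trans (hCP 0 h01)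
  have hN0 : 0 ≤ N := (norm_nonneg _).trans (hN 0 h01)
  have hQ0 : 0 ≤ Q := (norm_nonneg _).trans (hQ 0 h01)
  have hK : ∀ᶠ y in 𝓝 x, ∀ t ∈ Icc (0 : ℝ) 1, ‖F t y‖ ≤ CF + 1 := by
    refine isCompact_Icc.eventually_forall_of_forall_eventually fun t ht => ?_
    filter_upwards [(hFc t ht).norm.eventually_lt (continuousAt_const (y := CF + 1))
      ((hCF t ht).trans_lt (lt_add_one _))] with z hz
    exact hz.le
  set G := (Real.exp (CF + 1) - 1) / (CF + 1) with hG
  have hG0 : 0 ≤ G := div_nonneg (by linarith [Real.add_one_le_exp (CF + 1)]) (by linarith)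
  refine .of_isLittleO (Asymptotics.isLittleO_iff.2 fun c hc => ?_)
  obtain ⟨ε, hε, hεc⟩ : ∃ ε > 0, (ε * (N + Q) + CP * Q * ε) * G ≤ c := by
    refine ⟨c / ((N + Q + CP * Q) * G + 1), by positivity, ?_⟩
    rw [show ∀ ε, (ε * (N + Q) + CP * Q * ε) * G = ε * ((N + Q + CP * Q) * G) by intro; ring,
      div_mul_eq_mul_div, div_le_iff₀ (by positivity)]
    nlinarith
  filter_upwards [h0, hh, hK, isCompact_Icc.eventually_norm_sub_sub_le hF hPc hε,
    Metric.closedBall_mem_nhds x (lt_min hε one_pos)] with y hy0 hy hKy hR hball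
  set v := y - x with hv
  obtain ⟨hvε, hv1⟩ : ‖v‖ ≤ ε ∧ ‖v‖ ≤ 1 := by
    simpa [hv, ← dist_eq_norm] using hball
  have hxx := hh.self_of_nhds
  have hd (t : ℝ) (ht : t ∈ Icc (0 : ℝ) 1) := (hy t ht).fun_sub ((hxx t ht).fun_add (hq t ht v))
  have key := norm_le_gronwallBound_of_norm_deriv_right_le (δ := 0) (K := CF + 1)
    (ε := (ε * (N + Q) + CP * Q * ε) * ‖v‖)
    (fun t ht => (hd t ht).continuousAt.continuousWithinAt)
    (fun t ht => (hd t (Ico_subset_Icc_self ht)).hasDerivWithinAt)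
    (by simp [hy0, h0.self_of_nhds, hq0]) (fun t ht => ?_) 1 ⟨zero_le_one, le_rfl⟩
  · rw [gronwallBound_of_K_ne_0 (by positivity)] at key
    calc _ = ‖h y 1 - (h x 1 + q 1 v)‖ := by rw [sub_sub]
      _ ≤ (ε * (N + Q) + CP * Q * ε) * G * ‖v‖ := key.trans_eq (by rw [hG]; ring_nf)
      _ ≤ c * ‖v‖ := by gcongr
  · replace ht := Ico_subset_Icc_self ht
    have hqv : ‖q t v‖ ≤ Q * ‖v‖ := (q t).le_of_opNorm_le (hQ t ht) v
    have hPv : ‖P t x v‖ ≤ CP * ‖v‖ := (P t x).le_of_opNorm_le (hCP t ht) v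
    have hsum : ‖h x t + q t v‖ ≤ N + Q :=
      norm_add_le_of_le (hN t ht) (hqv.trans (mul_le_of_le_one_right hQ0 hv1))
    calc _ = ‖F t y * (h y t - (h x t + q t v)) +
            ((F t y - F t x - P t x v) * (h x t + q t v) + P t x v * q t v)‖ := by
          congr 1; noncomm_ring
      _ ≤ (CF + 1) * ‖h y t - (h x t + q t v)‖ +
            (ε * ‖v‖ * (N + Q) + CP * ‖v‖ * (Q * ε)) := by
          refine norm_add_le_of_le (norm_mul_le_of_le (hKy t ht) le_rfl)
            (norm_add_le_of_le (norm_mul_le_of_le (hR t ht) hsum)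
              (norm_mul_le_of_le hPv (hqv.trans (by gcongr))))
      _ = _ := by ring

/-- A solution `g` of a linear total differential equation `dg = T g` with smooth `T` is smooth. -/
theorem contDiffOn_infty_of_hasFDerivAt_apply {V E : Type*} [NormedAddCommGroup V]
    [NormedSpace ℝ V] [NormedAddCommGroup E] [NormedSpace ℝ E] {U : Set V} (hU : IsOpen U)
    {T : V → E →L[ℝ] V →L[ℝ] E} (hT : ContDiffOn ℝ (⊤ : ℕ∞) T U) {g : V → E}
    (hg : ∀ x ∈ U, HasFDerivAt g (T x (g x)) x) : ContDiffOn ℝ (⊤ : ℕ∞) g U := by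
  have hd : DifferentiableOn ℝ g U := fun x hx => (hg x hx).differentiableAt.differentiableWithinAt
  refine contDiffOn_infty.2 fun m => ?_
  induction m with
  | zero => exact contDiffOn_zero.2 hd.continuousOn
  | succ m ih =>
    push_cast
    refine (contDiffOn_succ_iff_fderiv_of_isOpen hU).2 ⟨hd, by simp, ?_⟩
    exact ((contDiffOn_infty.1 hT m).clm_apply ih).congr fun x hx => (hg x hx).fderiv

/-- On a star-shaped open set, the total differential equation `dg = Ω g` with flat `Ω` has a solution
with invertible values and `g 0 = 1`. -/
theorem exists_isUnit_hasFDerivAt_mul {A V : Type*} [NormedRing A] [NormedAlgebra ℝ A]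
    [CompleteSpace A] [NormedAddCommGroup V] [NormedSpace ℝ V] {U : Set V} (hU : IsOpen U)
    (hstar : ∀ x ∈ U, ∀ t ∈ Icc (0 : ℝ) 1, t • x ∈ U) {Ω : V → V →L[ℝ] A}
    (hΩ : ContDiffOn ℝ 1 Ω U)
    (hflat : ∀ x ∈ U, ∀ v w,
      fderiv ℝ Ω x v w - fderiv ℝ Ω x w v = Ω x v * Ω x w - Ω x w * Ω x v) :
    ∃ g : V → A, g 0 = 1 ∧ (∀ x ∈ U, IsUnit (g x)) ∧
      ∀ x ∈ U, HasFDerivAt g (((ContinuousLinearMap.mul ℝ A).flip (g x)).comp (Ω x)) x := by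
  have hsol : ∀ x ∈ U, ∃ h : ℝ → A, h 0 = 1 ∧
      (∀ t ∈ Icc (0 : ℝ) 1, HasDerivAt h (Ω (t • x) x * h t) t) ∧ IsUnit (h 1) := by
    intro x hx
    let b : Icc (0 : ℝ) 1 → A := fun t => Ω ((t : ℝ) • x) x
    have hb : Continuous b := by
      refine Continuous.clm_apply ?_ continuous_const
      exact hΩ.continuousOn.comp_continuous (by fun_prop) fun t => hstar x hx t t.2
    obtain ⟨M, hM⟩ := isCompact_univ.exists_bound_of_continuousOn hb.continuousOn
    obtain ⟨h, h0, hh, hu⟩ := exists_isUnit_hasDerivAt_mul (B := IccExtend zero_le_one b)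
      hb.Icc_extend' fun t => hM _ trivial
    refine ⟨h, h0, fun t ht => ?_, hu 1⟩
    simpa [IccExtend_of_mem _ _ ht] using hh t
  rcases U.eq_empty_or_nonempty with rfl | ⟨x₀, hx₀⟩
  · exact ⟨1, by simp⟩
  choose! h h0 hh hu using hsol
  refine ⟨fun x => h x 1, ?_, hu, fun x hx => ?_⟩
  · have hU0 : (0 : V) ∈ U := by simpa using hstar x₀ hx₀ 0 ⟨le_rfl, zero_le_one⟩
    rw [← h0 0 hU0]
    exact constant_of_has_deriv_right_zero
      (fun t ht => (hh 0 hU0 t ht).continuousAt.continuousWithinAt)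
      (fun t ht => by simpa using (hh 0 hU0 t (Ico_subset_Icc_self ht)).hasDerivWithinAt)
      1 ⟨zero_le_one, le_rfl⟩
  have hΩd {y : V} (hy : y ∈ U) : HasFDerivAt Ω (fderiv ℝ Ω y) y :=
    ((hΩ.differentiableOn one_ne_zero).differentiableAt (hU.mem_nhds hy)).hasFDerivAt
  have hΩc {t : ℝ} (ht : t ∈ Icc (0 : ℝ) 1) :
      ContinuousAt (fun z : V × ℝ => Ω (z.2 • z.1)) (x, t) :=
    ContinuousAt.comp (x := (x, t)) (f := fun z : V × ℝ => z.2 • z.1)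
      (hΩd (hstar x hx t ht)).continuousAt (by fun_prop)
  have hdΩc {t : ℝ} (ht : t ∈ Icc (0 : ℝ) 1) :
      ContinuousAt (fun z : V × ℝ => fderiv ℝ Ω (z.2 • z.1)) (x, t) :=
    ContinuousAt.comp (x := (x, t)) (f := fun z : V × ℝ => z.2 • z.1)
      ((hΩ.continuousOn_fderiv_of_isOpen hU le_rfl).continuousAt
        (hU.mem_nhds (hstar x hx t ht))) (by fun_prop)
  let q : ℝ → V →L[ℝ] A := fun t =>
    t • ((ContinuousLinearMap.mul ℝ A).flip (h x t)).comp (Ω (t • x))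
  have hq1 : q 1 = ((ContinuousLinearMap.mul ℝ A).flip (h x 1)).comp (Ω x) := by simp [q]
  rw [← hq1]
  refine hasFDerivAt_of_hasDerivAt_mul (F := fun t y => Ω (t • y) y)
    (P := fun t y => t • (fderiv ℝ Ω (t • y)).flip y + Ω (t • y)) (a := 1)
    (fun t ht => ?_) (fun t ht => (hΩc ht).clm_apply continuousAt_fst) (fun t ht => ?_)
    ?_ ?_ (q := q) (by simp [q]) (fun t ht => ?_) (fun t ht v => ?_)
  · have : ContinuousAt (fun z : V × ℝ => z.2 • z.1) (x, t) := by fun_prop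
    filter_upwards [this (hU.mem_nhds (hstar x hx t ht))] with z hz
    have hz' : HasFDerivAt (fun y => Ω (z.2 • y))
        ((fderiv ℝ Ω (z.2 • z.1)).comp (z.2 • ContinuousLinearMap.id ℝ V)) z.1 :=
      HasFDerivAt.comp (f := fun y => z.2 • y) z.1 (hΩd hz) ((hasFDerivAt_id z.1).const_smul z.2)
    refine (hz'.clm_apply (hasFDerivAt_id z.1)).congr_fderiv ?_
    ext v
    simp [add_comm]
  · refine ContinuousAt.add (continuousAt_snd.smul (ContinuousAt.clm_apply ?_ continuousAt_fst))
      (hΩc ht)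
    exact (ContinuousLinearMap.flipₗᵢ ℝ V V A).continuous.continuousAt.comp (hdΩc ht)
  · filter_upwards [hU.mem_nhds hx] with y hy using h0 y hy
  · filter_upwards [hU.mem_nhds hx] with y hy using hh y hy
  · have hpair : ContinuousAt (fun s : ℝ => (x, s)) t := by fun_prop
    have h1 : ContinuousAt (fun s : ℝ => Ω (s • x)) t :=
      ContinuousAt.comp (x := t) (g := fun z : V × ℝ => Ω (z.2 • z.1)) (hΩc ht) hpair
    have h2 : ContinuousAt (fun s : ℝ => (ContinuousLinearMap.mul ℝ A).flip (h x s)) t :=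
      (ContinuousLinearMap.continuous _).continuousAt.comp (hh x hx t ht).continuousAt
    exact (continuousAt_id.smul (h2.clm_comp h1)).continuousWithinAt
  · have hxt := hstar x hx t ht
    have h1 : HasDerivAt (fun s : ℝ => Ω (s • x)) (fderiv ℝ Ω (t • x) x) t :=
      HasFDerivAt.comp_hasDerivAt (f := fun s : ℝ => s • x) t (hΩd hxt)
        (by simpa using (hasDerivAt_id t).smul_const x)
    have h2 : HasDerivAt (fun s : ℝ => Ω (s • x) v) (fderiv ℝ Ω (t • x) x v) t := by
      simpa using h1.clm_apply (hasDerivAt_const t v)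
    have h3 : HasDerivAt (fun s => q s v) _ t :=
      (hasDerivAt_id t).fun_smul (h2.fun_mul (hh x hx t ht))
    refine h3.congr_deriv ?_
    have := hflat _ hxt x v
    rw [sub_eq_iff_eq_add] at this
    simp only [this]
    simp [q, add_mul, sub_mul, mul_assoc, smul_add, smul_sub]
    abel

/-- **Non-Abelian Poincaré lemma for 1-forms.**  On an open set `U ⊆ ℝⁿ` star-shaped
with respect to `0`, any smooth `A`-valued 1-form `ω` (with components `ω · i`)
satisfying the Maurer–Cartan equation
`∂_i ω_j - ∂_j ω_i + ω_i ω_j - ω_j ω_i = 0` has a multiplicative primitive: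
a smooth `g : U → A` with `g 0 = 1`, `g x` a unit, and `ω_i = -∂_i g · g⁻¹` on `U`. -/
theorem nonabelian_poincare_lemma
    {A : Type*} [NormedRing A] [NormedAlgebra ℝ A] [CompleteSpace A]
    {n : ℕ} (U : Set (Fin n → ℝ)) (hU : IsOpen U)
    (hstar : ∀ x ∈ U, ∀ t ∈ Set.Icc (0:ℝ) 1, t • x ∈ U)
    (ω : (Fin n → ℝ) → Fin n → A)
    (hω : ContDiffOn ℝ (⊤ : ℕ∞) ω U)
    (hMC : ∀ i j : Fin n, ∀ x ∈ U,
      fderiv ℝ (fun y => ω y j) x (Pi.single i 1)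
        - fderiv ℝ (fun y => ω y i) x (Pi.single j 1)
        + ω x i * ω x j - ω x j * ω x i = 0) :
    ∃ g : (Fin n → ℝ) → A,
      ContDiffOn ℝ (⊤ : ℕ∞) g U ∧ g 0 = 1 ∧ (∀ x ∈ U, IsUnit (g x)) ∧
      ∀ i : Fin n, ∀ x ∈ U,
        ω x i = -(fderiv ℝ g x (Pi.single i 1)) * Ring.inverse (g x) := by
  let Ω : (Fin n → ℝ) → (Fin n → ℝ) →L[ℝ] A := fun x =>
    -∑ i, (ContinuousLinearMap.proj i).smulRight (ω x i)
  have hΩa (x v : Fin n → ℝ) : Ω x v = -∑ i, v i • ω x i := by simp [Ω]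
  have hωi (i : Fin n) : ContDiffOn ℝ (⊤ : ℕ∞) (fun x => ω x i) U := contDiffOn_pi.1 hω i
  have hΩ : ContDiffOn ℝ (⊤ : ℕ∞) Ω U :=
    (ContDiffOn.sum fun i _ => contDiffOn_const.smulRight (hωi i)).neg
  have hflat : ∀ x ∈ U, ∀ v w,
      fderiv ℝ Ω x v w - fderiv ℝ Ω x w v = Ω x v * Ω x w - Ω x w * Ω x v := by
    intro x hx v w
    have hd (i : Fin n) : DifferentiableAt ℝ (fun y => ω y i) x :=
      ((hωi i).differentiableOn (by simp)).differentiableAt (hU.mem_nhds hx)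
    have hΩd : DifferentiableAt ℝ Ω x :=
      (hΩ.differentiableOn (by simp)).differentiableAt (hU.mem_nhds hx)
    have hD (v w : Fin n → ℝ) : fderiv ℝ Ω x v w =
        -∑ j, ∑ i, (v i * w j) • fderiv ℝ (fun y => ω y j) x (Pi.single i 1) := by
      have h1 : fderiv ℝ Ω x v w = fderiv ℝ (fun y => Ω y w) x v := by
        rw [(hΩd.hasFDerivAt.clm_apply (hasFDerivAt_const w x)).fderiv]
        simp
      have h2 : HasFDerivAt (fun y => Ω y w) (-∑ j, w j • fderiv ℝ (fun y => ω y j) x) x := by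
        simp only [hΩa]
        exact (HasFDerivAt.fun_sum fun j _ => (hd j).hasFDerivAt.const_smul (w j)).neg
      have h3 (l : (Fin n → ℝ) →L[ℝ] A) : l v = ∑ i, v i • l (Pi.single i 1) := by
        conv_lhs => rw [pi_eq_sum_univ' v]
        simp
      rw [h1, h2.fderiv]
      simp [h3 (fderiv ℝ _ x), Finset.smul_sum, smul_smul, mul_comm]
    have hmul (v w : Fin n → ℝ) : Ω x v * Ω x w = ∑ j, ∑ i, (v i * w j) • (ω x i * ω x j) := by
      simp only [hΩa, neg_mul_neg, Finset.sum_mul_sum, smul_mul_smul_comm]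
      exact Finset.sum_comm
    rw [hD, hD, hmul, hmul, Finset.sum_comm (f := fun j i => (w i * v j) • (ω x i * ω x j)),
      Finset.sum_comm (f := fun j i => (w i * v j) • fderiv ℝ (fun y => ω y j) x (Pi.single i 1)),
      ← sub_eq_zero]
    simp only [neg_sub_neg, ← Finset.sum_sub_distrib]
    refine Finset.sum_eq_zero fun j _ => Finset.sum_eq_zero fun i _ => ?_
    rw [mul_comm (w j), ← smul_sub, ← smul_sub, ← smul_sub, smul_eq_zero]
    right
    rw [← neg_eq_zero, ← hMC i j x hx]
    abel
  obtain ⟨g, hg0, hgu, hg⟩ := exists_isUnit_hasFDerivAt_mul hU hstar (hΩ.of_le (by simp)) hflat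
  refine ⟨g, ?_, hg0, hgu, fun i x hx => ?_⟩
  · exact contDiffOn_infty_of_hasFDerivAt_apply hU
      (T := fun x => ((ContinuousLinearMap.compL ℝ (Fin n → ℝ) A A).flip (Ω x)).comp
        (ContinuousLinearMap.mul ℝ A).flip)
      (((ContinuousLinearMap.contDiff _).comp_contDiffOn hΩ).clm_comp contDiffOn_const) hg
  · rw [(hg x hx).fderiv]
    simp [hΩa, Pi.single_apply, Ring.mul_inverse_cancel_right _ _ (hgu x hx)]
end

section
/- (Explicit multiplicative primitive on a star-shaped domain.) Let A be a real unital Banach algebra, U ⊆ ℝⁿ an open set star-shaped with respect to 0, and ω : U → Fin n → A a smooth family of components ω_i satisfying ∂_i ω_j − ∂_j ω_i + ω_i ω_j − ω_j ω_i = 0 on U for all i, j. For x ∈ U define g(x) = h_x(1), where h_x : [0,1] → A is the unique solution of h_x(0) = 1 and h_x'(t) = −( Σ_i x_i · ω_i(t•x) ) · h_x(t). Then g is differentiable on U, g(x) is invertible for every x ∈ U, g(0) = 1, and ω_i(x) = −∂_i g(x) · g(x)⁻¹ for all i and x ∈ U. -/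
open Set Filter Topology

/-- A solution of a linear equation `h' = -a h` with bounded coefficient that starts at `1`
stays invertible. -/
theorem isUnit_of_hasDerivAt_neg_mul {A : Type*} [NormedRing A] [NormedAlgebra ℝ A]
    [CompleteSpace A] {h a : ℝ → A} {K : ℝ} (h0 : h 0 = 1)
    (hh : ∀ t ∈ Icc (0 : ℝ) 1, HasDerivAt h (-a t * h t) t)
    (ha : ∀ t ∈ Icc (0 : ℝ) 1, ‖a t‖ ≤ K) :
    ∀ t ∈ Icc (0 : ℝ) 1, IsUnit (h t) := by
  nontriviality A
  have hK : 0 ≤ K := (norm_nonneg _).trans (ha 0 (by simp))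
  have hcont : ContinuousOn h (Icc 0 1) := fun t ht => (hh t ht).continuousAt.continuousWithinAt
  by_contra! ⟨t₁, ht₁, hn₁⟩
  have hcomp : IsCompact (Icc (0 : ℝ) 1 ∩ h ⁻¹' nonunits A) :=
    isCompact_Icc.of_isClosed_subset
      (hcont.preimage_isClosed_of_isClosed isClosed_Icc nonunits.isClosed) inter_subset_left
  obtain ⟨t, ⟨ht, hn⟩, hmin⟩ := hcomp.exists_isLeast ⟨t₁, ht₁, hn₁⟩
  have hunit : ∀ s ∈ Ico 0 t, IsUnit (h s) := fun s hs => by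
    by_contra hs'
    exact absurd (hmin ⟨⟨hs.1, hs.2.le.trans ht.2⟩, hs'⟩) (not_le.2 hs.2)
  have ht0 : 0 < t := by
    refine ht.1.lt_of_ne ?_
    rintro rfl
    exact hn (by simp [h0])
  have hinv : ∀ s ∈ Ico 0 t, HasDerivAt (fun s => Ring.inverse (h s))
      (Ring.inverse (h s) * a s) s := fun s hs => by
    obtain ⟨u, hu⟩ := hunit s hs
    have h1 := hasFDerivAt_ringInverse (𝕜 := ℝ) u
    rw [hu] at h1
    have h2 := h1.comp_hasDerivAt s (hh s ⟨hs.1, hs.2.le.trans ht.2⟩)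
    convert! h2 using 1
    simp [← hu, mul_assoc]
  have hbound : ∀ s ∈ Ico 0 t, ‖Ring.inverse (h s)‖ ≤ ‖(1 : A)‖ * Real.exp K := fun s hs => by
    have := norm_le_gronwallBound_of_norm_deriv_right_le (a := 0) (b := s) (δ := ‖(1 : A)‖) (K := K)
      (ε := 0) (fun r hr => (hinv r ⟨hr.1, hr.2.trans_lt hs.2⟩).continuousAt.continuousWithinAt)
      (fun r hr => (hinv r ⟨hr.1, hr.2.trans hs.2⟩).hasDerivWithinAt) (by simp [h0])
      (fun r hr => by
        rw [add_zero, mul_comm K]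
        exact (norm_mul_le _ _).trans (mul_le_mul_of_nonneg_left
          (ha r ⟨hr.1, (hr.2.trans hs.2).le.trans ht.2⟩) (norm_nonneg _))) s ⟨hs.1, le_rfl⟩
    rw [gronwallBound_ε0, sub_zero] at this
    refine this.trans ?_
    gcongr
    nlinarith [hs.2, ht.2]
  have hC : 0 < ‖(1 : A)‖ * Real.exp K := mul_pos (norm_pos_iff.2 one_ne_zero) K.exp_pos
  obtain ⟨s, hs, hst⟩ : ∃ s, s ∈ Ico 0 t ∧ ‖h t - h s‖ < (‖(1 : A)‖ * Real.exp K)⁻¹ := by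
    have h1 : ∀ᶠ s in 𝓝[<] t, ‖h t - h s‖ < (‖(1 : A)‖ * Real.exp K)⁻¹ := by
      have : Tendsto (fun s => ‖h t - h s‖) (𝓝[<] t) (𝓝 ‖h t - h t‖) :=
        ((tendsto_const_nhds.sub (hh t ht).continuousAt.tendsto).norm).mono_left
          nhdsWithin_le_nhds
      refine this.eventually_lt_const ?_
      simpa using hC
    exact (Filter.Eventually.and (Ico_mem_nhdsLT ht0) h1).exists
  obtain ⟨u, hu⟩ := hunit s hs
  have hub := hbound s hs
  rw [← hu, Ring.inverse_unit] at hub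
  refine hn ⟨u.ofNearby (h t) ?_, rfl⟩
  rw [hu]
  exact hst.trans_le (inv_anti₀ (Units.norm_pos _) hub)

/-- If `P` is continuous at every point of `{x} × [0, 1]`, then `P (y, t)` is close to `P (x, t)`
uniformly in `t ∈ [0, 1]` for `y` near `x`. -/
theorem eventually_forall_norm_sub_lt {X F : Type*} [TopologicalSpace X]
    [NormedAddCommGroup F] {P : X × ℝ → F} {x : X}
    (hP : ∀ t ∈ Icc (0 : ℝ) 1, ContinuousAt P (x, t)) {ε : ℝ} (hε : 0 < ε) :
    ∀ᶠ y in 𝓝 x, ∀ t ∈ Icc (0 : ℝ) 1, ‖P (y, t) - P (x, t)‖ < ε := by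
  refine isCompact_Icc.eventually_forall_of_forall_eventually
    (P := fun y t => ‖P (y, t) - P (x, t)‖ < ε) fun t ht => ?_
  have h1 : ContinuousAt (fun p : X × ℝ => P (x, p.2)) (x, t) :=
    ContinuousAt.comp (f := fun p : X × ℝ => (x, p.2)) (x := (x, t)) (hP t ht) (by fun_prop)
  refine (((hP t ht).sub h1).norm.tendsto).eventually_lt_const ?_
  simpa using hε

section Radial

variable {E A : Type*} [NormedAddCommGroup E] [NormedSpace ℝ E]
  [NormedRing A] [NormedAlgebra ℝ A] {U : Set E} {Ω : E → E →L[ℝ] A}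

/-- The derivative in `y` of the radial component `Ω (t • y) y` of a one-form. -/
noncomputable def radialDeriv (Ω : E → E →L[ℝ] A) (y : E) (t : ℝ) : E →L[ℝ] A :=
  Ω (t • y) + t • (fderiv ℝ Ω (t • y)).flip y

theorem hasFDerivAt_radial {y : E} {t : ℝ} (hΩ : DifferentiableAt ℝ Ω (t • y)) :
    HasFDerivAt (fun y => Ω (t • y) y) (radialDeriv Ω y t) y := by
  have h1 : HasFDerivAt (fun y : E => t • y) (t • ContinuousLinearMap.id ℝ E) y :=
    (hasFDerivAt_id y).const_smul t
  have h2 := (hΩ.hasFDerivAt.comp y h1).clm_apply (hasFDerivAt_id y)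
  convert! h2 using 1
  ext v
  simp [radialDeriv]

theorem continuousAt_radial {y : E} {t : ℝ} (hΩ : ContinuousAt Ω (t • y)) :
    ContinuousAt (fun p : E × ℝ => Ω (p.2 • p.1) p.1) (y, t) := by
  have h1 : ContinuousAt (fun p : E × ℝ => Ω (p.2 • p.1)) (y, t) :=
    ContinuousAt.comp (f := fun p : E × ℝ => p.2 • p.1) (x := (y, t)) hΩ (by fun_prop)
  exact h1.clm_apply continuousAt_fst

theorem continuousAt_radialDeriv {y : E} {t : ℝ} (hΩ : ContinuousAt Ω (t • y))
    (hΩ' : ContinuousAt (fderiv ℝ Ω) (t • y)) :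
    ContinuousAt (fun p : E × ℝ => radialDeriv Ω p.1 p.2) (y, t) := by
  have h1 : ContinuousAt (fun p : E × ℝ => Ω (p.2 • p.1)) (y, t) :=
    ContinuousAt.comp (f := fun p : E × ℝ => p.2 • p.1) (x := (y, t)) hΩ (by fun_prop)
  have h2 : ContinuousAt (fun p : E × ℝ => fderiv ℝ Ω (p.2 • p.1)) (y, t) :=
    ContinuousAt.comp (f := fun p : E × ℝ => p.2 • p.1) (x := (y, t)) hΩ' (by fun_prop)
  have h3 : ContinuousAt (fun p : E × ℝ => (fderiv ℝ Ω (p.2 • p.1)).flip) (y, t) :=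
    (ContinuousLinearMap.flipₗᵢ ℝ E E A).continuous.continuousAt.comp h2
  exact h1.add (continuousAt_snd.smul (h3.clm_apply continuousAt_fst))

/-- The first-order Taylor expansion of the radial component, uniform along the ray. -/
theorem eventually_forall_radial_taylor (hU : IsOpen U)
    (hstar : ∀ x ∈ U, ∀ t ∈ Icc (0 : ℝ) 1, t • x ∈ U) (hΩ : ContDiffOn ℝ 1 Ω U)
    {x : E} (hx : x ∈ U) {ε : ℝ} (hε : 0 < ε) :
    ∀ᶠ y in 𝓝 x, ∀ t ∈ Icc (0 : ℝ) 1,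
      ‖Ω (t • y) y - Ω (t • x) x - radialDeriv Ω x t (y - x)‖ ≤ ε * ‖y - x‖ := by
  have hΩ' := hΩ.continuousOn_fderiv_of_isOpen hU le_rfl
  have h1 := eventually_forall_norm_sub_lt (P := fun p : E × ℝ => radialDeriv Ω p.1 p.2) (x := x)
    (fun t ht => continuousAt_radialDeriv
      (hΩ.continuousOn.continuousAt (hU.mem_nhds (hstar x hx t ht)))
      (hΩ'.continuousAt (hU.mem_nhds (hstar x hx t ht)))) hε
  obtain ⟨r, hr, hball⟩ := 
    Metric.eventually_nhds_iff_ball.1 ((hU.eventually_mem hx).and h1)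
  filter_upwards [Metric.ball_mem_nhds x hr] with y hy t ht
  exact Convex.norm_image_sub_le_of_norm_hasFDerivWithin_le' (𝕜 := ℝ) (s := Metric.ball x r)
    (f := fun y => Ω (t • y) y) (f' := fun y => radialDeriv Ω y t)
    (fun z hz => (hasFDerivAt_radial ((hΩ.differentiableOn one_ne_zero).differentiableAt
      (hU.mem_nhds (hstar z (hball z hz).1 t ht)))).hasFDerivWithinAt)
    (fun z hz => ((hball z hz).2 t ht).le) (convex_ball x r) (Metric.mem_ball_self hr) hy

/-- The derivative along a ray of the difference between the increment of the transported
functions and its expected linear part. -/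
theorem hasDerivAt_radial_defect {x y : E} {t : ℝ} (hΩ : DifferentiableAt ℝ Ω (t • x))
    (hflat : ∀ u v, fderiv ℝ Ω (t • x) u v - fderiv ℝ Ω (t • x) v u
      + Ω (t • x) u * Ω (t • x) v - Ω (t • x) v * Ω (t • x) u = 0)
    {k h : ℝ → A} (hk : HasDerivAt k (-Ω (t • y) y * k t) t)
    (hh : HasDerivAt h (-Ω (t • x) x * h t) t) (v : E) :
    HasDerivAt (fun t => k t - h t + t • Ω (t • x) v * h t)
      (-Ω (t • y) y * (k t - h t + t • Ω (t • x) v * h t)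
        - (Ω (t • y) y - Ω (t • x) x - radialDeriv Ω x t v) * h t
        + (Ω (t • y) y - Ω (t • x) x) * (t • Ω (t • x) v) * h t) t := by
  have h1 : HasDerivAt (fun t : ℝ => t • x) x t := by
    simpa using (hasDerivAt_id t).smul_const x
  have h2 : HasDerivAt (fun t : ℝ => Ω (t • x) v) (fderiv ℝ Ω (t • x) x v) t := by
    have h : HasDerivAt (fun t : ℝ => Ω (t • x)) (fderiv ℝ Ω (t • x) x) t :=
      hΩ.hasFDerivAt.comp_hasDerivAt t h1
    exact (ContinuousLinearMap.apply ℝ A v).hasFDerivAt.comp_hasDerivAt t h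
  have h3 : HasDerivAt (fun t : ℝ => t • Ω (t • x) v)
      (t • fderiv ℝ Ω (t • x) x v + (1 : ℝ) • Ω (t • x) v) t :=
    HasDerivAt.fun_smul (hasDerivAt_id' t) h2
  have h4 := (hk.fun_sub hh).fun_add (h3.fun_mul hh)
  have hf : fderiv ℝ Ω (t • x) x v = fderiv ℝ Ω (t • x) v x
      + Ω (t • x) v * Ω (t • x) x - Ω (t • x) x * Ω (t • x) v := by
    rw [← sub_eq_zero, ← hflat x v]
    abel
  refine h4.congr_deriv ?_
  simp only [radialDeriv, add_apply, smul_apply, ContinuousLinearMap.flip_apply, one_smul, hf]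
  simp only [mul_add, mul_sub, add_mul, sub_mul, smul_add, smul_sub, smul_mul_assoc,
    mul_smul_comm, neg_mul, mul_neg, mul_assoc, smul_neg]
  abel

/-- Transporting `1` along the rays by a flat one-form `Ω` on a star-shaped open set yields a
function `g` with `dg = -Ω g`. -/
theorem hasFDerivAt_radial_transport (hU : IsOpen U)
    (hstar : ∀ x ∈ U, ∀ t ∈ Icc (0 : ℝ) 1, t • x ∈ U) (hΩ : ContDiffOn ℝ 1 Ω U)
    (hflat : ∀ x ∈ U, ∀ u v,
      fderiv ℝ Ω x u v - fderiv ℝ Ω x v u + Ω x u * Ω x v - Ω x v * Ω x u = 0)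
    {h : E → ℝ → A} (h0 : ∀ x ∈ U, h x 0 = 1)
    (hh : ∀ x ∈ U, ∀ t ∈ Icc (0 : ℝ) 1, HasDerivAt (h x) (-Ω (t • x) x * h x t) t)
    {x : E} (hx : x ∈ U) :
    HasFDerivAt (fun y => h y 1) (-((ContinuousLinearMap.mul ℝ A).flip (h x 1) ∘L Ω x)) x := by
  have hmem : ∀ t ∈ Icc (0 : ℝ) 1, U ∈ 𝓝 (t • x) := fun t ht => hU.mem_nhds (hstar x hx t ht)
  have hcΩ : ContinuousOn (fun t : ℝ => Ω (t • x)) (Icc 0 1) :=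
    hΩ.continuousOn.comp (by fun_prop) fun t ht => hstar x hx t ht
  obtain ⟨W, hW⟩ := isCompact_Icc.exists_bound_of_continuousOn hcΩ
  obtain ⟨H, hH⟩ := isCompact_Icc.exists_bound_of_continuousOn
    (fun t ht => (hh x hx t ht).continuousAt.continuousWithinAt : ContinuousOn (h x) (Icc 0 1))
  have hW0 : 0 ≤ W := (norm_nonneg _).trans (hW 0 (by simp))
  have hH0 : 0 ≤ H := (norm_nonneg _).trans (hH 0 (by simp))
  have hcr : ∀ t ∈ Icc (0 : ℝ) 1, ContinuousAt (fun p : E × ℝ => Ω (p.2 • p.1) p.1) (x, t) :=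
    fun t ht => continuousAt_radial (hΩ.continuousOn.continuousAt (hmem t ht))
  set K := W * ‖x‖ + 1
  have hK : 0 < K := by positivity
  set M := (Real.exp K - 1) / K with hM
  have hM0 : 0 ≤ M := div_nonneg (by linarith [Real.add_one_le_exp K]) hK.le
  rw [hasFDerivAt_iff_isLittleO, Asymptotics.isLittleO_iff]
  intro c hc
  obtain ⟨ε, hε, hεc⟩ : ∃ ε > 0, ε * (H * (1 + W)) * M ≤ c := by
    have hB : 0 ≤ H * (1 + W) * M := by positivity
    refine ⟨c / (H * (1 + W) * M + 1), by positivity, ?_⟩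
    rw [mul_assoc, div_mul_eq_mul_div, div_le_iff₀ (by positivity)]
    nlinarith
  filter_upwards [hU.mem_nhds hx, eventually_forall_radial_taylor hU hstar hΩ hx hε,
    eventually_forall_norm_sub_lt hcr hε, eventually_forall_norm_sub_lt hcr one_pos]
    with y hy htaylor hsub hsub1
  set v := y - x
  have hderiv := fun t ht => hasDerivAt_radial_defect
    ((hΩ.differentiableOn one_ne_zero).differentiableAt (hmem t ht))
    (hflat _ (hstar x hx t ht)) (hh y hy t ht) (hh x hx t ht) v
  have hg := norm_le_gronwallBound_of_norm_deriv_right_le (a := 0) (b := 1) (δ := 0) (K := K)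
    (ε := ε * (H * (1 + W)) * ‖v‖)
    (fun t ht => (hderiv t ht).continuousAt.continuousWithinAt)
    (fun t ht => (hderiv t (Ico_subset_Icc_self ht)).hasDerivWithinAt)
    (by simp [h0 x hx, h0 y hy]) ?_ 1 (by simp)
  · rw [gronwallBound_of_K_ne_0 hK.ne'] at hg
    have e : ε * (H * (1 + W)) * ‖v‖ / K * (Real.exp K - 1)
        = ε * (H * (1 + W)) * M * ‖v‖ := by rw [hM]; ring
    simp only [one_smul, zero_mul, zero_add, sub_zero, mul_one, e] at hg
    refine le_trans (le_of_eq ?_) (hg.trans (by gcongr))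
    simp
  · intro t ht'
    have ht := Ico_subset_Icc_self ht'
    have hay : ‖Ω (t • y) y‖ ≤ K := by
      have e1 : ‖Ω (t • x) x‖ ≤ W * ‖x‖ := (Ω (t • x)).le_of_opNorm_le (hW t ht) x
      have e2 := norm_le_norm_add_norm_sub' (Ω (t • y) y) (Ω (t • x) x)
      linarith [hsub1 t ht]
    have htv : ‖t • Ω (t • x) v‖ ≤ W * ‖v‖ := by
      rw [norm_smul, Real.norm_of_nonneg ht.1]
      have e1 := (Ω (t • x)).le_of_opNorm_le (hW t ht) v
      nlinarith [norm_nonneg (Ω (t • x) v), ht.2]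
    refine (norm_add_le _ _).trans ((add_le_add (norm_sub_le _ _) le_rfl).trans ?_)
    have b1 := norm_mul_le_of_le (show ‖-Ω (t • y) y‖ ≤ K by rwa [norm_neg])
      (le_refl ‖h y t - h x t + t • Ω (t • x) v * h x t‖)
    have b2 := norm_mul_le_of_le (htaylor t ht) (hH t ht)
    have b3 := norm_mul_le_of_le (norm_mul_le_of_le (hsub t ht).le htv) (hH t ht)
    linarith

end Radial

section Components

variable {A : Type*} [NormedRing A] [NormedAlgebra ℝ A] {n : ℕ}

/-- The one-form `∑ i, a i dxᵢ` with components `a`. -/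
noncomputable def formOfComponents (a : Fin n → A) : (Fin n → ℝ) →L[ℝ] A :=
  ∑ i, (ContinuousLinearMap.proj i : (Fin n → ℝ) →L[ℝ] ℝ).smulRight (a i)

theorem formOfComponents_apply (a : Fin n → A) (v : Fin n → ℝ) :
    formOfComponents a v = ∑ i, v i • a i := by
  simp [formOfComponents]

theorem formOfComponents_single (a : Fin n → A) (i : Fin n) :
    formOfComponents a (Pi.single i 1) = a i := by
  simp [formOfComponents_apply, Pi.single_apply]

theorem ContDiffOn.formOfComponents {U : Set (Fin n → ℝ)} {ω : (Fin n → ℝ) → Fin n → A}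
    {m : WithTop ℕ∞} (hω : ContDiffOn ℝ m ω U) :
    ContDiffOn ℝ m (fun x => formOfComponents (ω x)) U := by
  refine ContDiffOn.sum fun i _ => ?_
  exact contDiffOn_const.smulRight (contDiffOn_pi.1 hω i)

theorem fderiv_formOfComponents_apply {ω : (Fin n → ℝ) → Fin n → A} {x : Fin n → ℝ}
    (hω : DifferentiableAt ℝ ω x) (u v : Fin n → ℝ) :
    fderiv ℝ (fun y => formOfComponents (ω y)) x u v =
      ∑ i, ∑ j, (u i * v j) • fderiv ℝ (fun y => ω y j) x (Pi.single i 1) := by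
  have hj := differentiableAt_pi.1 hω
  have h : HasFDerivAt (fun y => formOfComponents (ω y))
      (∑ j, (ContinuousLinearMap.smulRightL ℝ (Fin n → ℝ) A (ContinuousLinearMap.proj j)) ∘L
        fderiv ℝ (fun y => ω y j) x) x :=
    HasFDerivAt.fun_sum fun j _ =>
      (ContinuousLinearMap.smulRightL ℝ (Fin n → ℝ) A
        (ContinuousLinearMap.proj j)).hasFDerivAt.comp x (hj j).hasFDerivAt
  have hu : u = ∑ i, u i • Pi.single (M := fun _ => ℝ) i (1 : ℝ) := by
    ext k
    simp [Pi.single_apply]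
  rw [h.fderiv, Finset.sum_comm]
  simp only [sum_apply]
  refine Finset.sum_congr rfl fun j _ => ?_
  change v j • fderiv ℝ (fun y => ω y j) x u = _
  conv_lhs => rw [hu]
  simp only [map_sum, map_smul, Finset.smul_sum, smul_smul, mul_comm]

theorem formOfComponents_mul (a b : Fin n → A) (u v : Fin n → ℝ) :
    formOfComponents a u * formOfComponents b v = ∑ i, ∑ j, (u i * v j) • (a i * b j) := by
  simp only [formOfComponents_apply, Finset.sum_mul_sum, smul_mul_smul_comm]

/-- The Maurer–Cartan equation in components implies its coordinate-free form. -/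
theorem formOfComponents_flat {ω : (Fin n → ℝ) → Fin n → A} {x : Fin n → ℝ}
    (hω : DifferentiableAt ℝ ω x)
    (hMC : ∀ i j : Fin n,
      fderiv ℝ (fun y => ω y j) x (Pi.single i 1) - fderiv ℝ (fun y => ω y i) x (Pi.single j 1)
        + ω x i * ω x j - ω x j * ω x i = 0) (u v : Fin n → ℝ) :
    fderiv ℝ (fun y => formOfComponents (ω y)) x u v
      - fderiv ℝ (fun y => formOfComponents (ω y)) x v u
      + formOfComponents (ω x) u * formOfComponents (ω x) v
      - formOfComponents (ω x) v * formOfComponents (ω x) u = 0 := by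
  rw [fderiv_formOfComponents_apply hω u v, fderiv_formOfComponents_apply hω v u,
    formOfComponents_mul, formOfComponents_mul,
    Finset.sum_comm (f := fun i j => (v i * u j) • fderiv ℝ (fun y => ω y j) x (Pi.single i 1)),
    Finset.sum_comm (f := fun i j => (v i * u j) • (ω x i * ω x j))]
  simp only [← Finset.sum_sub_distrib, ← Finset.sum_add_distrib]
  refine Finset.sum_eq_zero fun i _ => Finset.sum_eq_zero fun j _ => ?_
  rw [mul_comm (v j), ← smul_sub, ← smul_add, ← smul_sub, hMC i j, smul_zero]

end Components


/-- **Explicit multiplicative primitive on a star-shaped domain.**  For a flat smooth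
`A`-valued 1-form `ω` on an open star-shaped (w.r.t. `0`) set `U ⊆ ℝⁿ`, let
`h x : ℝ → A` solve `h x 0 = 1` and `(h x)'(t) = -(Σ_i x_i • ω_i (t • x)) · h x t`
on `[0,1]` (the multiplicative integral of the pullback of `ω` by the contraction
`H(x,t) = t • x`).  Then `g x := h x 1` is differentiable on `U`, invertible-valued,
`g 0 = 1`, and `ω_i x = -∂_i g x · (g x)⁻¹` on `U`. -/
theorem nonabelian_poincare_explicit_primitive
    {A : Type*} [NormedRing A] [NormedAlgebra ℝ A] [CompleteSpace A]
    {n : ℕ} (U : Set (Fin n → ℝ)) (hU : IsOpen U)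
    (hstar : ∀ x ∈ U, ∀ t ∈ Set.Icc (0:ℝ) 1, t • x ∈ U)
    (hU0 : (0 : Fin n → ℝ) ∈ U)
    (ω : (Fin n → ℝ) → Fin n → A)
    (hω : ContDiffOn ℝ (⊤ : ℕ∞) ω U)
    (hMC : ∀ i j : Fin n, ∀ x ∈ U,
      fderiv ℝ (fun y => ω y j) x (Pi.single i 1)
        - fderiv ℝ (fun y => ω y i) x (Pi.single j 1)
        + ω x i * ω x j - ω x j * ω x i = 0)
    (h : (Fin n → ℝ) → ℝ → A)
    (hh0 : ∀ x ∈ U, h x 0 = 1)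
    (hh' : ∀ x ∈ U, ∀ t ∈ Set.Icc (0:ℝ) 1,
      HasDerivAt (h x) (-(∑ i : Fin n, x i • ω (t • x) i) * h x t) t) :
    DifferentiableOn ℝ (fun x => h x 1) U ∧
    (∀ x ∈ U, IsUnit (h x 1)) ∧
    h 0 1 = 1 ∧
    ∀ i : Fin n, ∀ x ∈ U,
      ω x i = -(fderiv ℝ (fun y => h y 1) x (Pi.single i 1)) * Ring.inverse (h x 1) := by
  have hΩ : ContDiffOn ℝ 1 (fun x => formOfComponents (ω x)) U :=
    (hω.of_le (by exact_mod_cast le_top)).formOfComponents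
  have hh : ∀ x ∈ U, ∀ t ∈ Icc (0 : ℝ) 1,
      HasDerivAt (h x) (-formOfComponents (ω (t • x)) x * h x t) t := fun x hx t ht => by
    rw [formOfComponents_apply]
    exact hh' x hx t ht
  have hderiv := fun x hx => hasFDerivAt_radial_transport hU hstar hΩ
    (fun x hx => formOfComponents_flat
      ((hω.differentiableOn (by simp)).differentiableAt (hU.mem_nhds hx)) (hMC · · x hx))
    hh0 hh (x := x) hx
  have hunit : ∀ x ∈ U, IsUnit (h x 1) := fun x hx => by
    have hc : ContinuousOn (fun t : ℝ => formOfComponents (ω (t • x)) x) (Icc 0 1) := fun t ht =>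
      ((continuousAt_radial (Ω := fun x => formOfComponents (ω x))
        (hΩ.continuousOn.continuousAt (hU.mem_nhds (hstar x hx t ht)))).comp
        (f := fun t : ℝ => (x, t)) (by fun_prop)).continuousWithinAt
    obtain ⟨K, hK⟩ := isCompact_Icc.exists_bound_of_continuousOn hc
    exact isUnit_of_hasDerivAt_neg_mul (hh0 x hx) (hh x hx) hK 1 (by simp)
  refine ⟨fun x hx => (hderiv x hx).differentiableAt.differentiableWithinAt, hunit, ?_,
    fun i x hx => ?_⟩
  · rw [← hh0 0 hU0]
    refine constant_of_has_deriv_right_zero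
      (fun t ht => (hh 0 hU0 t ht).continuousAt.continuousWithinAt)
      (fun t ht => ?_) 1 (by simp)
    simpa using (hh 0 hU0 t (Ico_subset_Icc_self ht)).hasDerivWithinAt (s := Ici t)
  · rw [(hderiv x hx).fderiv]
    simp [formOfComponents_single, mul_assoc, Ring.mul_inverse_cancel _ (hunit x hx)]
end

section
/- (Gauge equivalence of flat forms on a star-shaped domain.) Let A be a real unital Banach algebra, U ⊆ ℝⁿ an open set star-shaped with respect to 0, and let ω, ω' : U → Fin n → A be two smooth families of components each satisfying the Maurer–Cartan equation ∂_i ω_j − ∂_j ω_i + ω_i ω_j − ω_j ω_i = 0 (and likewise for ω') on U. Then ω and ω' are gauge-equivalent: there exists a smooth map g : U → A with g(x) invertible for every x ∈ U and ω'_i(x) = g(x)·ω_i(x)·g(x)⁻¹ − ∂_i g(x)·g(x)⁻¹ for all i and x ∈ U. -/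
open Set Filter Topology

theorem norm_iterated_integral_le {E : Type*} [NormedAddCommGroup E] [NormedSpace ℝ E]
    {N : ℝ → E →L[ℝ] E} {K C : ℝ} (hK : ∀ t, ‖N t‖ ≤ K) {f : ℝ → E} {k : ℕ}
    (hf : ∀ t, ‖f t‖ ≤ C * (K * |t|) ^ k / k.factorial) (t : ℝ) :
    ‖∫ s in (0 : ℝ)..t, N s (f s)‖ ≤ C * (K * |t|) ^ (k + 1) / (k + 1).factorial := by
  have hK0 : 0 ≤ K := (norm_nonneg _).trans (hK 0)
  calc ‖∫ s in (0 : ℝ)..t, N s (f s)‖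
      ≤ |∫ s in (0 : ℝ)..t, K * (C * (K * |s|) ^ k / k.factorial)| := by
        refine intervalIntegral.norm_integral_le_abs_of_norm_le (.of_forall fun s => ?_)
          (Continuous.intervalIntegrable (by fun_prop) _ _)
        exact (N s).le_of_opNorm_le_of_le (hK s) (hf s)
    _ = |K * C * K ^ k / k.factorial * ∫ s in (0 : ℝ)..t, |s| ^ k| := by
        rw [← intervalIntegral.integral_const_mul]
        congr 2 with s
        ring
    _ = |C * K ^ (k + 1) / k.factorial| * (|t| ^ (k + 1) / (k + 1)) := by
        have h : |∫ s in (0 : ℝ)..t, |s| ^ k| = |t| ^ (k + 1) / (k + 1) := by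
          rw [intervalIntegral.abs_intervalIntegral_eq]
          have := integral_pow_abs_sub_uIoc (a := 0) (b := t) (n := k)
          simp only [sub_zero] at this
          rw [this, abs_of_nonneg (by positivity)]
        rw [abs_mul, h]
        congr 2
        ring
    _ = C * (K * |t|) ^ (k + 1) / (k + 1).factorial := by
        have hC : 0 ≤ C * K ^ (k + 1) := by
          have := (norm_nonneg _).trans (hf 1)
          have h2 : 0 ≤ C * K ^ k := by
            simpa using (le_div_iff₀ (by positivity)).1 this
          calc 0 ≤ (C * K ^ k) * K := by positivity
            _ = _ := by ring
        rw [abs_of_nonneg (by positivity), Nat.factorial_succ]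
        push_cast
        field_simp
        ring

theorem exists_linear_ode_solution {E : Type*} [NormedAddCommGroup E] [NormedSpace ℝ E]
    [CompleteSpace E] {M : ℝ → E →L[ℝ] E} (hM : ContinuousOn M (Icc 0 1)) (w₀ : E) :
    ∃ w : ℝ → E, w 0 = w₀ ∧
      ∀ t ∈ Icc (0 : ℝ) 1, HasDerivWithinAt w (M t (w t)) (Icc 0 1) t := by
  set N : ℝ → E →L[ℝ] E := IccExtend zero_le_one ((Icc (0 : ℝ) 1).domRestrict M)
  have hNc : Continuous N := hM.domRestrict.Icc_extend'
  have hNM : ∀ t ∈ Icc (0 : ℝ) 1, N t = M t := fun t ht => IccExtend_of_mem _ _ ht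
  obtain ⟨K, hK⟩ : ∃ K, ∀ t, ‖N t‖ ≤ K := by
    obtain ⟨K, hK⟩ := isCompact_Icc.exists_bound_of_continuousOn hM
    exact ⟨K, fun t => hK _ (projIcc (0 : ℝ) 1 zero_le_one t).2⟩
  have hK0 : 0 ≤ K := (norm_nonneg _).trans (hK 0)
  let a : ℕ → ℝ → E := fun k =>
    Nat.rec (fun _ => w₀) (fun _ b t => ∫ s in (0 : ℝ)..t, N s (b s)) k
  have ha : ∀ k t, a (k + 1) t = ∫ s in (0 : ℝ)..t, N s (a k s) := fun _ _ => rfl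
  have hd' : ∀ k, Continuous (a k) → ∀ t, HasDerivAt (a (k + 1)) (N t (a k t)) t := by
    intro k hk t
    exact (hNc.clm_apply hk).integral_hasStrictDerivAt 0 t |>.hasDerivAt
  have hac : ∀ k, Continuous (a k) := by
    intro k
    induction k with
    | zero => exact continuous_const
    | succ k ih => exact continuous_iff_continuousAt.2 fun t => (hd' k ih t).continuousAt
  have hd := fun k => hd' k (hac k)
  have hb : ∀ k t, ‖a k t‖ ≤ ‖w₀‖ * (K * |t|) ^ k / k.factorial := by
    intro k
    induction k with
    | zero => intro t; simp [a]
    | succ k ih => exact norm_iterated_integral_le hK ih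
  have hs0 : ∀ r : ℝ, Summable fun k : ℕ => ‖w₀‖ * r ^ k / k.factorial := by
    intro r
    simpa only [mul_div_assoc] using (Real.summable_pow_div_factorial r).mul_left ‖w₀‖
  have hs : ∀ t, Summable fun k => a k t := fun t => .of_norm_bounded (hs0 _) fun k => hb k t
  have hsum : ∀ t ∈ Metric.ball (0 : ℝ) 2,
      HasDerivAt (fun t => ∑' k, a (k + 1) t) (∑' k, N t (a k t)) t := by
    intro t ht
    refine hasDerivAt_tsum_of_isPreconnected (g := fun k => a (k + 1))
      (g' := fun k t => N t (a k t)) ((hs0 (K * 2)).mul_left K) Metric.isOpen_ball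
      (convex_ball _ _).isPreconnected (fun k y _ => hd k y) (fun k y hy => ?_)
      (Metric.mem_ball_self two_pos) ((summable_nat_add_iff 1).2 (hs 0)) ht
    refine (N y).le_of_opNorm_le_of_le (hK y) ((hb k y).trans ?_)
    have : |y| ≤ 2 := by simpa using (Metric.mem_ball.1 hy).le
    gcongr
  refine ⟨fun t => w₀ + ∑' k, a (k + 1) t, by simp [ha], fun t ht => ?_⟩
  have htb : t ∈ Metric.ball (0 : ℝ) 2 := by
    rw [Metric.mem_ball, dist_zero_right, Real.norm_eq_abs, abs_of_nonneg ht.1]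
    linarith [ht.2]
  have h := ((hsum t htb).const_add w₀).hasDerivWithinAt (s := Icc 0 1)
  have e : M t (w₀ + ∑' k, a (k + 1) t) = ∑' k, N t (a k t) := by
    rw [← (N t).map_tsum (hs t), (hs t).tsum_eq_zero_add, hNM t ht]
    rfl
  rwa [e]

theorem norm_le_of_linear_deriv_bound {E : Type*} [NormedAddCommGroup E] [NormedSpace ℝ E]
    {f f' : ℝ → E} {K ε : ℝ} (hK : 0 < K)
    (hf : ∀ t ∈ Icc (0 : ℝ) 1, HasDerivWithinAt f (f' t) (Icc 0 1) t) (h0 : f 0 = 0)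
    (hbound : ∀ t ∈ Icc (0 : ℝ) 1, ‖f' t‖ ≤ K * ‖f t‖ + ε) :
    ∀ t ∈ Icc (0 : ℝ) 1, ‖f t‖ ≤ ε / K * (Real.exp (K * t) - 1) := by
  intro t ht
  have := norm_le_gronwallBound_of_norm_deriv_right_le (δ := 0) (K := K) (ε := ε) (f := f)
    (f' := f') (a := 0) (b := 1) (fun t ht => (hf t ht).continuousWithinAt)
    (fun t ht => (hf t (Ico_subset_Icc_self ht)).mono_of_mem_nhdsWithin
      (Icc_mem_nhdsGE_of_mem ht)) (by simp [h0])
    (fun t ht => hbound t (Ico_subset_Icc_self ht)) t ht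
  simpa [gronwallBound_of_K_ne_0 hK.ne'] using this

theorem eventually_norm_le_of_hasFDerivAt_zero {F G : Type*} [NormedAddCommGroup F]
    [NormedSpace ℝ F] [NormedAddCommGroup G] [NormedSpace ℝ G] {Q : F × ℝ → G} {S : Set ℝ}
    (hS : IsCompact S) (hQ : ∀ t ∈ S, ContDiffAt ℝ 1 Q (0, t)) (h0 : ∀ t, Q (0, t) = 0)
    (hd : ∀ t ∈ S, HasFDerivAt (fun v => Q (v, t)) (0 : F →L[ℝ] G) 0) {ε : ℝ} (hε : 0 < ε) :
    ∀ᶠ v in 𝓝 (0 : F), ∀ t ∈ S, ‖Q (v, t)‖ ≤ ε * ‖v‖ := by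
  refine hS.eventually_forall_of_forall_eventually fun t ht => ?_
  have hs := (hQ t ht).hasStrictFDerivAt one_ne_zero
  have hinl : ∀ v, fderiv ℝ Q (0, t) (v, 0) = 0 := by
    have hi : HasFDerivAt (fun v : F => (v, t)) (ContinuousLinearMap.inl ℝ F ℝ) 0 :=
      hasFDerivAt_prodMk_left 0 t
    have h := (hs.hasFDerivAt.comp (0 : F) hi).unique (hd t ht)
    exact fun v => congr($h v)
  have hlim : Tendsto (fun p : F × ℝ => (p, ((0 : F), p.2))) (𝓝 (0, t))
      (𝓝 ((0, t), (0, t))) := by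
    apply Continuous.tendsto' (by fun_prop)
    rfl
  filter_upwards [(hs.isLittleO.comp_tendsto hlim).def hε] with p hp
  have e : p - (0, p.2) = (p.1, 0) := by ext <;> simp
  simpa only [Function.comp_apply, e, hinl, h0, sub_zero, Prod.norm_mk, norm_zero,
    max_eq_left (norm_nonneg _)] using hp

theorem ContDiffAt.fderiv_smul_snd_apply {F G : Type*} [NormedAddCommGroup F] [NormedSpace ℝ F]
    [NormedAddCommGroup G] [NormedSpace ℝ G] {f : F → G} {x : F} {t : ℝ}
    (hf : ContDiffAt ℝ (⊤ : ℕ∞) f (t • x)) :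
    ContDiffAt ℝ 1 (fun p : F × ℝ => fderiv ℝ f (p.2 • x) x) (0, t) :=
  (ContDiffAt.comp (0, t) (f := fun p : F × ℝ => p.2 • x) (g := fderiv ℝ f)
    (hf.fderiv_right (m := 1) (WithTop.coe_le_coe.2 (le_top : (1 + 1 : ℕ∞) ≤ ⊤)))
    (by fun_prop)).clm_apply contDiffAt_const

theorem ContDiffOn.clm_bilin_comp {F E X Y : Type*} [NormedAddCommGroup F] [NormedSpace ℝ F]
    [NormedAddCommGroup E] [NormedSpace ℝ E] [NormedAddCommGroup X] [NormedSpace ℝ X]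
    [NormedAddCommGroup Y] [NormedSpace ℝ Y] {m : WithTop ℕ∞} {s : F → E} {U : Set F}
    (hs : ContDiffOn ℝ m s U) (Ψ : E →L[ℝ] X →L[ℝ] Y) : ContDiffOn ℝ m (fun x => Ψ (s x)) U :=
  Ψ.contDiff.comp_contDiffOn hs

section Parallel

variable {E F : Type*} [NormedAddCommGroup E] [NormedSpace ℝ E] [NormedAddCommGroup F]
  [NormedSpace ℝ F] {U : Set F} {L : F → F →L[ℝ] E →L[ℝ] E}

/-- Flatness of the connection `d - L`. -/
def IsFlatOn (L : F → F →L[ℝ] E →L[ℝ] E) (U : Set F) : Prop :=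
  ∀ x ∈ U, ∀ v w, fderiv ℝ L x v w - fderiv ℝ L x w v
    + (L x w ∘L L x v) - (L x v ∘L L x w) = 0

/-- The defect in the equation along the ray through `x + v` of the first-order expansion in `v`
of a parallel section along the rays. -/
noncomputable def rayDefect (L : F → F →L[ℝ] E →L[ℝ] E) (x : F) (p : F × ℝ) : E →L[ℝ] E :=
  L (p.2 • x) x + L (p.2 • x) p.1 + p.2 • fderiv ℝ L (p.2 • x) x p.1
    + p.2 • (L (p.2 • x) p.1 ∘L L (p.2 • x) x)
    - L (p.2 • (x + p.1)) (x + p.1) ∘L (.id ℝ E + p.2 • L (p.2 • x) p.1)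

theorem contDiffAt_rayDefect (hU : IsOpen U) (hL : ContDiffOn ℝ (⊤ : ℕ∞) L U) {x : F} {t : ℝ}
    (hx : t • x ∈ U) : ContDiffAt ℝ 1 (rayDefect L x) (0, t) := by
  have hLx : ContDiffAt ℝ (⊤ : ℕ∞) L (t • x) := hL.contDiffAt (hU.mem_nhds hx)
  have h1 : ContDiffAt ℝ 1 (fun p : F × ℝ => L (p.2 • x)) (0, t) :=
    (hLx.of_le (by simp)).comp (0, t) (f := fun p : F × ℝ => p.2 • x) (by fun_prop)
  have h3 : ContDiffAt ℝ 1 (fun p : F × ℝ => L (p.2 • (x + p.1))) (0, t) :=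
    ContDiffAt.comp (0, t) (f := fun p : F × ℝ => p.2 • (x + p.1))
      (by simpa using hLx.of_le (by simp)) (by fun_prop)
  have hfst : ContDiffAt ℝ 1 (fun p : F × ℝ => p.1) (0, t) := contDiffAt_fst
  have hsnd : ContDiffAt ℝ 1 (fun p : F × ℝ => p.2) (0, t) := contDiffAt_snd
  have h4 := h1.clm_apply hfst
  have h5 := h1.clm_apply (contDiffAt_const (c := x))
  exact (((h5.add h4).add
    (hsnd.smul (hLx.fderiv_smul_snd_apply.clm_apply hfst))).add
      (hsnd.smul (h4.clm_comp h5))).sub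
        ((h3.clm_apply (contDiffAt_const.add hfst)).clm_comp
          (contDiffAt_const.add (hsnd.smul h4)))

theorem hasFDerivAt_rayDefect (hU : IsOpen U) (hL : ContDiffOn ℝ (⊤ : ℕ∞) L U)
    (hflat : IsFlatOn L U) {x : F} {t : ℝ} (hx : t • x ∈ U) :
    HasFDerivAt (fun v => rayDefect L x (v, t)) (0 : F →L[ℝ] E →L[ℝ] E) 0 := by
  have hLx : HasFDerivAt L (fderiv ℝ L (t • x)) (t • x) :=
    ((hL.contDiffAt (hU.mem_nhds hx)).differentiableAt (by simp)).hasFDerivAt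
  have hid : HasFDerivAt (fun v : F => v) (.id ℝ F) 0 := hasFDerivAt_id 0
  have hadd : HasFDerivAt (fun v : F => x + v) (.id ℝ F) 0 := hid.const_add x
  have h3 : HasFDerivAt (fun v : F => L (t • (x + v)))
      ((fderiv ℝ L (t • x)).comp (t • .id ℝ F)) 0 :=
    HasFDerivAt.comp (0 : F) (g := L) (f := fun v : F => t • (x + v)) (by simpa using hLx)
      (hadd.const_smul t)
  have h4 : HasFDerivAt (fun v : F => L (t • x) v) (L (t • x)) 0 := (L (t • x)).hasFDerivAt
  have h5 : HasFDerivAt (fun v : F => fderiv ℝ L (t • x) x v) (fderiv ℝ L (t • x) x) 0 :=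
    (fderiv ℝ L (t • x) x).hasFDerivAt
  have h := (((h4.const_add (L (t • x) x)).add (h5.const_smul t)).add
    ((h4.clm_comp (hasFDerivAt_const (L (t • x) x) 0)).const_smul t)).sub
      ((h3.clm_apply hadd).clm_comp ((h4.const_smul t).const_add (.id ℝ E)))
  refine h.congr_fderiv ?_
  ext v e
  have hf := congr(t • ($(hflat _ hx x v) e))
  simp [smul_sub, smul_add] at hf ⊢
  rw [← hf]
  abel

theorem eventually_norm_apply_ray_le (hU : IsOpen U) (hL : ContinuousOn L U) {x : F}
    (hx : ∀ t ∈ Icc (0 : ℝ) 1, t • x ∈ U) :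
    ∃ K > 0, ∀ᶠ v in 𝓝 (0 : F), ∀ t ∈ Icc (0 : ℝ) 1, ‖L (t • (x + v)) (x + v)‖ ≤ K := by
  have hc : ∀ t ∈ Icc (0 : ℝ) 1,
      ContinuousAt (fun p : F × ℝ => L (p.2 • (x + p.1)) (x + p.1)) (0, t) := by
    intro t ht
    have h : ContinuousAt L (t • (x + 0)) := by
      simpa using hL.continuousAt (hU.mem_nhds (hx t ht))
    exact (ContinuousAt.comp (x := ((0 : F), t)) (f := fun p : F × ℝ => p.2 • (x + p.1)) h
      (by fun_prop)).clm_apply (by fun_prop)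
  obtain ⟨K, hK⟩ := isCompact_Icc.exists_bound_of_continuousOn (s := Icc (0 : ℝ) 1)
    (f := fun t => L (t • (x + 0)) (x + 0)) fun t ht =>
      (ContinuousAt.comp (x := t) (f := fun t : ℝ => ((0 : F), t)) (hc t ht)
        (by fun_prop)).continuousWithinAt
  have hK0 : 0 ≤ K := (norm_nonneg _).trans (hK 0 (by simp))
  refine ⟨K + 1, by positivity, isCompact_Icc.eventually_forall_of_forall_eventually
    fun t ht => ?_⟩
  filter_upwards [(hc t ht).norm.eventually_lt continuousAt_const
    ((hK t ht).trans_lt (lt_add_one K))] with p hp using hp.le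

theorem eqOn_of_parallel (hstar : ∀ x ∈ U, ∀ t ∈ Icc (0 : ℝ) 1, t • x ∈ U)
    (hU : IsOpen U) (hL : ContinuousOn L U) {s₁ s₂ : F → E}
    (h₁ : ∀ x ∈ U, HasFDerivAt s₁ ((L x).flip (s₁ x)) x)
    (h₂ : ∀ x ∈ U, HasFDerivAt s₂ ((L x).flip (s₂ x)) x) (h0 : s₁ 0 = s₂ 0) :
    EqOn s₁ s₂ U := by
  intro x hx
  obtain ⟨K, hK0, hK⟩ := eventually_norm_apply_ray_le hU hL (hstar x hx)
  have hK := hK.self_of_nhds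
  simp only [add_zero] at hK
  have hray : ∀ t : ℝ, HasDerivAt (fun t : ℝ => t • x) x t := fun t => by
    simpa using (hasDerivAt_id t).smul_const x
  have := norm_le_of_linear_deriv_bound (f := fun t => s₁ (t • x) - s₂ (t • x))
    (f' := fun t => L (t • x) x (s₁ (t • x)) - L (t • x) x (s₂ (t • x))) (ε := 0) hK0
    (fun t ht => (((h₁ _ (hstar x hx t ht)).comp_hasDerivAt t (hray t)).sub
      ((h₂ _ (hstar x hx t ht)).comp_hasDerivAt t (hray t))).hasDerivWithinAt)
    (by simp [h0]) (fun t ht => by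
      rw [← map_sub, add_zero]
      exact (L (t • x) x).le_of_opNorm_le (hK t ht) _) 1 (by simp)
  simpa [sub_eq_zero] using this

theorem contDiffOn_of_parallel (hU : IsOpen U) (hL : ContDiffOn ℝ (⊤ : ℕ∞) L U) {s : F → E}
    (h : ∀ x ∈ U, HasFDerivAt s ((L x).flip (s x)) x) : ContDiffOn ℝ (⊤ : ℕ∞) s U := by
  have hd : DifferentiableOn ℝ s U := fun x hx =>
    (h x hx).differentiableAt.differentiableWithinAt
  refine contDiffOn_infty.2 fun k => ?_
  induction k with
  | zero => exact contDiffOn_zero.2 hd.continuousOn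
  | succ k ih =>
    rw [Nat.cast_succ, contDiffOn_succ_iff_fderiv_of_isOpen hU]
    refine ⟨hd, by simp, ?_⟩
    have heval : ContDiffOn ℝ k (fun x => ContinuousLinearMap.apply ℝ E (s x)) U :=
      ih.clm_bilin_comp _
    exact (heval.clm_comp (hL.of_le (WithTop.coe_le_coe.2 (le_top : (k : ℕ∞) ≤ ⊤)))).congr
      fun x hx => (h x hx).fderiv

theorem exists_parallel_section [CompleteSpace E] (hU : IsOpen U) (hne : U.Nonempty)
    (hstar : ∀ x ∈ U, ∀ t ∈ Icc (0 : ℝ) 1, t • x ∈ U)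
    (hL : ContDiffOn ℝ (⊤ : ℕ∞) L U) (hflat : IsFlatOn L U) (s₀ : E) :
    ∃ s : F → E, s 0 = s₀ ∧ ∀ x ∈ U, HasFDerivAt s ((L x).flip (s x)) x := by
  have hex : ∀ x ∈ U, ∃ w : ℝ → E, w 0 = s₀ ∧
      ∀ t ∈ Icc (0 : ℝ) 1, HasDerivWithinAt w (L (t • x) x (w t)) (Icc 0 1) t := fun x hx =>
    exists_linear_ode_solution (M := fun t => L (t • x) x)
      ((hL.continuousOn.comp (by fun_prop) fun t ht => hstar x hx t ht).clm_apply
        continuousOn_const) s₀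
  choose! w hw0 hw using hex
  have h0 : (0 : F) ∈ U := by
    obtain ⟨x, hx⟩ := hne
    simpa using hstar x hx 0 (by simp)
  refine ⟨fun x => w x 1, ?_, fun x hx => ?_⟩
  · have := norm_le_of_linear_deriv_bound (f := fun t => w 0 t - s₀) (f' := fun _ => 0)
      (ε := 0) one_pos (fun t ht => by simpa using (hw 0 h0 t ht).sub_const s₀)
      (by simp [hw0 0 h0]) (fun t ht => by simp) 1 (by simp)
    simpa [sub_eq_zero] using this
  obtain ⟨K, hK0, hK⟩ := eventually_norm_apply_ray_le hU hL.continuousOn (hstar x hx)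
  obtain ⟨C, hC⟩ := isCompact_Icc.exists_bound_of_continuousOn (s := Icc (0 : ℝ) 1) (f := w x)
    fun t ht => (hw x hx t ht).continuousWithinAt
  have hC0 : 0 ≤ C := (norm_nonneg _).trans (hC 0 (by simp))
  have hexp : 0 ≤ Real.exp K - 1 := by linarith [Real.add_one_le_exp K]
  set D : ℝ := C / K * (Real.exp K - 1) with hD
  have hD0 : 0 ≤ D := by positivity
  rw [hasFDerivAt_iff_isLittleO_nhds_zero, Asymptotics.isLittleO_iff]
  intro c hc
  have hmem : ∀ᶠ v in 𝓝 (0 : F), x + v ∈ U :=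
    ContinuousAt.eventually_mem (f := fun v => x + v) (by fun_prop)
      (by simpa using hU.mem_nhds hx)
  have hQ := eventually_norm_le_of_hasFDerivAt_zero (Q := rayDefect L x) isCompact_Icc
    (fun t ht => contDiffAt_rayDefect hU hL (hstar x hx t ht))
    (fun t => by ext; simp [rayDefect])
    (fun t ht => hasFDerivAt_rayDefect hU hL hflat (hstar x hx t ht))
    (ε := c / (D + 1)) (by positivity)
  filter_upwards [hK, hmem, hQ] with v hKv hv hQv
  have hz : ∀ t ∈ Icc (0 : ℝ) 1, HasDerivWithinAt
      (fun t => w x t + t • L (t • x) v (w x t) - w (x + v) t)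
      (L (t • (x + v)) (x + v) (w x t + t • L (t • x) v (w x t) - w (x + v) t)
        + rayDefect L x (v, t) (w x t)) (Icc 0 1) t := by
    intro t ht
    have hray : HasDerivAt (fun t : ℝ => t • x) x t := by
      simpa using (hasDerivAt_id t).smul_const x
    have hLt : HasDerivWithinAt (fun t : ℝ => L (t • x)) (fderiv ℝ L (t • x) x) (Icc 0 1) t :=
      (HasFDerivAt.comp_hasDerivAt t (l := L) (f := fun t : ℝ => t • x)
        ((hL.contDiffAt (hU.mem_nhds (hstar x hx t ht))).differentiableAt
          (by simp)).hasFDerivAt hray).hasDerivWithinAt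
    have hLv := (hLt.clm_apply (hasDerivWithinAt_const t _ v)).clm_apply (hw x hx t ht)
    refine (((hw x hx t ht).add ((hasDerivWithinAt_id t _).smul hLv)).sub
      (hw _ hv t ht)).congr_deriv ?_
    simp [rayDefect, smul_add]
    abel
  have hfin := norm_le_of_linear_deriv_bound (ε := c / (D + 1) * ‖v‖ * C) hK0 hz
    (by simp [hw0 x hx, hw0 _ hv])
    (fun t ht => norm_add_le_of_le ((L _ _).le_of_opNorm_le (hKv t ht) _)
      ((rayDefect L x (v, t)).le_of_opNorm_le_of_le (hQv t ht) (hC t ht))) 1 (by simp)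
  simp only [one_smul, mul_one] at hfin
  rw [norm_sub_rev] at hfin
  calc _ = ‖w (x + v) 1 - (w x 1 + L x v (w x 1))‖ := by simp [sub_sub]
    _ ≤ _ := hfin
    _ = c * ‖v‖ * (D / (D + 1)) := by rw [hD]; field_simp
    _ ≤ c * ‖v‖ := mul_le_of_le_one_right (by positivity)
      ((div_le_one (by positivity)).2 (by linarith))

end Parallel

theorem isFlatOn_of_pi_single {E : Type*} [NormedAddCommGroup E] [NormedSpace ℝ E] {n : ℕ}
    {U : Set (Fin n → ℝ)} {L : (Fin n → ℝ) → (Fin n → ℝ) →L[ℝ] E →L[ℝ] E}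
    (h : ∀ x ∈ U, ∀ (i j : Fin n) (e : E),
      fderiv ℝ L x (Pi.single i 1) (Pi.single j 1) e
        - fderiv ℝ L x (Pi.single j 1) (Pi.single i 1) e
        + L x (Pi.single j 1) (L x (Pi.single i 1) e)
        - L x (Pi.single i 1) (L x (Pi.single j 1) e) = 0) :
    IsFlatOn L U := by
  intro x hx v w
  let T : (Fin n → ℝ) →ₗ[ℝ] (Fin n → ℝ) →ₗ[ℝ] (E →L[ℝ] E) :=
    LinearMap.mk₂ ℝ (fun v w => fderiv ℝ L x v w - fderiv ℝ L x w v
        + (L x w ∘L L x v) - (L x v ∘L L x w))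
      (fun v v' w => by ext e; simp; abel)
      (fun c v w => by ext e; simp [smul_sub, smul_add])
      (fun v w w' => by ext e; simp; abel)
      (fun c v w => by ext e; simp [smul_sub, smul_add])
  have hT : T = 0 := by
    refine LinearMap.ext_basis (Pi.basisFun ℝ (Fin n)) (Pi.basisFun ℝ (Fin n)) fun i j => ?_
    ext e
    simpa [T] using h x hx i j e
  exact congr($hT v w)

theorem ContDiffOn.sum_proj_smulRight {F G : Type*} [NormedAddCommGroup F] [NormedSpace ℝ F]
    [NormedAddCommGroup G] [NormedSpace ℝ G] {n : ℕ} {m : WithTop ℕ∞} {B : Fin n → F → G}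
    {U : Set F} (hB : ∀ i, ContDiffOn ℝ m (B i) U) :
    ContDiffOn ℝ m
      (fun x => ∑ i, (ContinuousLinearMap.proj i : (Fin n → ℝ) →L[ℝ] ℝ).smulRight (B i x)) U :=
  ContDiffOn.sum fun i _ => (ContinuousLinearMap.smulRightL ℝ (Fin n → ℝ) G
    (.proj i)).contDiff.comp_contDiffOn (hB i)

theorem fderiv_sum_proj_smulRight_apply {F G : Type*} [NormedAddCommGroup F] [NormedSpace ℝ F]
    [NormedAddCommGroup G] [NormedSpace ℝ G] {n : ℕ} {B : Fin n → F → G} {x : F}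
    (hB : ∀ i, DifferentiableAt ℝ (B i) x) (v : F) (j : Fin n) :
    fderiv ℝ (fun x => ∑ i, (ContinuousLinearMap.proj i : (Fin n → ℝ) →L[ℝ] ℝ).smulRight (B i x))
      x v (Pi.single j 1) = fderiv ℝ (B j) x v := by
  have h := HasFDerivAt.fun_sum (u := Finset.univ) fun i _ =>
    (ContinuousLinearMap.smulRightL ℝ (Fin n → ℝ) G (.proj i)).hasFDerivAt.comp x
      (hB i).hasFDerivAt
  refine congr($(h.fderiv) v (Pi.single j 1)).trans ?_
  simp [Pi.single_apply]

section Gauge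

variable {A : Type*} [NormedRing A] [NormedAlgebra ℝ A] {n : ℕ}

/-- The connection form whose parallel sections are the solutions `g` of
`∂_i g = g * a_i - b_i * g`. -/
noncomputable def gaugeConnection (a b : Fin n → A) : (Fin n → ℝ) →L[ℝ] A →L[ℝ] A :=
  ∑ i, (ContinuousLinearMap.proj i : (Fin n → ℝ) →L[ℝ] ℝ).smulRight
    ((ContinuousLinearMap.mul ℝ A).flip (a i) - ContinuousLinearMap.mul ℝ A (b i))

theorem gaugeConnection_apply (a b : Fin n → A) (v : Fin n → ℝ) (e : A) :
    gaugeConnection a b v e = ∑ i, v i • (e * a i - b i * e) := by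
  simp [gaugeConnection]

theorem gaugeConnection_single (a b : Fin n → A) (i : Fin n) (e : A) :
    gaugeConnection a b (Pi.single i 1) e = e * a i - b i * e := by
  rw [gaugeConnection_apply, Finset.sum_eq_single i] <;> simp +contextual

theorem gaugeConnection_self_one (a : Fin n → A) (v : Fin n → ℝ) :
    gaugeConnection a a v 1 = 0 := by
  simp [gaugeConnection_apply]

theorem mul_gaugeConnection_add (a b c : Fin n → A) (v : Fin n → ℝ) (g k : A) :
    g * gaugeConnection c a v k + gaugeConnection a b v g * k
      = gaugeConnection c b v (g * k) := by
  simp only [gaugeConnection_apply, Finset.mul_sum, Finset.sum_mul, ← Finset.sum_add_distrib]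
  refine Finset.sum_congr rfl fun i _ => ?_
  rw [mul_smul_comm, smul_mul_assoc, ← smul_add]
  congr 1
  noncomm_ring

theorem HasFDerivAt.mul_parallel {a b c : Fin n → A} {g k : (Fin n → ℝ) → A} {x : Fin n → ℝ}
    (hg : HasFDerivAt g ((gaugeConnection a b).flip (g x)) x)
    (hk : HasFDerivAt k ((gaugeConnection c a).flip (k x)) x) :
    HasFDerivAt (g * k) ((gaugeConnection c b).flip ((g * k) x)) x := by
  refine (hg.mul' hk).congr_fderiv ?_
  ext1 v
  simpa using mul_gaugeConnection_add a b c v (g x) (k x)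

theorem hasFDerivAt_one_parallel (a : Fin n → A) (x : Fin n → ℝ) :
    HasFDerivAt (1 : (Fin n → ℝ) → A)
      ((gaugeConnection a a).flip ((1 : (Fin n → ℝ) → A) x)) x := by
  refine (hasFDerivAt_const (1 : A) x).congr_fderiv ?_
  ext1 v
  simp [gaugeConnection_self_one]

variable {U : Set (Fin n → ℝ)} {ω ω' : (Fin n → ℝ) → Fin n → A}

theorem contDiffOn_gaugeConnection (hω : ContDiffOn ℝ (⊤ : ℕ∞) ω U)
    (hω' : ContDiffOn ℝ (⊤ : ℕ∞) ω' U) :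
    ContDiffOn ℝ (⊤ : ℕ∞) (fun x => gaugeConnection (ω x) (ω' x)) U :=
  .sum_proj_smulRight fun i =>
    ((ContinuousLinearMap.mul ℝ A).flip.contDiff.comp_contDiffOn (contDiffOn_pi.1 hω i)).sub
      ((ContinuousLinearMap.mul ℝ A).contDiff.comp_contDiffOn (contDiffOn_pi.1 hω' i))

theorem fderiv_gaugeConnection_apply {x : Fin n → ℝ} (hω : DifferentiableAt ℝ ω x)
    (hω' : DifferentiableAt ℝ ω' x) (v : Fin n → ℝ) (j : Fin n) (e : A) :
    fderiv ℝ (fun x => gaugeConnection (ω x) (ω' x)) x v (Pi.single j 1) e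
      = e * fderiv ℝ (fun y => ω y j) x v - fderiv ℝ (fun y => ω' y j) x v * e := by
  have hB := fun i =>
    ((ContinuousLinearMap.mul ℝ A).flip.hasFDerivAt.comp x
      (differentiableAt_pi.1 hω i).hasFDerivAt).sub
    ((ContinuousLinearMap.mul ℝ A).hasFDerivAt.comp x
      (differentiableAt_pi.1 hω' i).hasFDerivAt)
  have h := fderiv_sum_proj_smulRight_apply (fun i => (hB i).differentiableAt) v j
  rw [(hB j).fderiv] at h
  exact congr($h e)

theorem isFlatOn_gaugeConnection (hω : ∀ x ∈ U, DifferentiableAt ℝ ω x)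
    (hω' : ∀ x ∈ U, DifferentiableAt ℝ ω' x)
    (hMC : ∀ i j : Fin n, ∀ x ∈ U,
      fderiv ℝ (fun y => ω y j) x (Pi.single i 1)
        - fderiv ℝ (fun y => ω y i) x (Pi.single j 1)
        + ω x i * ω x j - ω x j * ω x i = 0)
    (hMC' : ∀ i j : Fin n, ∀ x ∈ U,
      fderiv ℝ (fun y => ω' y j) x (Pi.single i 1)
        - fderiv ℝ (fun y => ω' y i) x (Pi.single j 1)
        + ω' x i * ω' x j - ω' x j * ω' x i = 0) :
    IsFlatOn (fun x => gaugeConnection (ω x) (ω' x)) U := by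
  refine isFlatOn_of_pi_single fun x hx i j e => ?_
  simp only [fderiv_gaugeConnection_apply (hω x hx) (hω' x hx), gaugeConnection_single]
  have key := congr(e * $(hMC i j x hx) - $(hMC' i j x hx) * e)
  rw [mul_zero, zero_mul, sub_zero] at key
  rw [← key]
  noncomm_ring

end Gauge

/-- **Gauge equivalence of flat forms on a star-shaped domain.**  Any two smooth
`A`-valued 1-forms `ω`, `ω'` on an open star-shaped (w.r.t. `0`) set `U ⊆ ℝⁿ`
satisfying the Maurer–Cartan equation are gauge-equivalent: there is a smooth
invertible-valued `g` with `ω'_i = g·ω_i·g⁻¹ - ∂_i g·g⁻¹` on `U`. -/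
theorem flat_forms_gauge_equivalent
    {A : Type*} [NormedRing A] [NormedAlgebra ℝ A] [CompleteSpace A]
    {n : ℕ} (U : Set (Fin n → ℝ)) (hU : IsOpen U)
    (hstar : ∀ x ∈ U, ∀ t ∈ Set.Icc (0:ℝ) 1, t • x ∈ U)
    (ω ω' : (Fin n → ℝ) → Fin n → A)
    (hω : ContDiffOn ℝ (⊤ : ℕ∞) ω U) (hω' : ContDiffOn ℝ (⊤ : ℕ∞) ω' U)
    (hMC : ∀ i j : Fin n, ∀ x ∈ U,
      fderiv ℝ (fun y => ω y j) x (Pi.single i 1)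
        - fderiv ℝ (fun y => ω y i) x (Pi.single j 1)
        + ω x i * ω x j - ω x j * ω x i = 0)
    (hMC' : ∀ i j : Fin n, ∀ x ∈ U,
      fderiv ℝ (fun y => ω' y j) x (Pi.single i 1)
        - fderiv ℝ (fun y => ω' y i) x (Pi.single j 1)
        + ω' x i * ω' x j - ω' x j * ω' x i = 0) :
    ∃ g : (Fin n → ℝ) → A,
      ContDiffOn ℝ (⊤ : ℕ∞) g U ∧ (∀ x ∈ U, IsUnit (g x)) ∧
      ∀ i : Fin n, ∀ x ∈ U,
        ω' x i = g x * ω x i * Ring.inverse (g x)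
          - fderiv ℝ g x (Pi.single i 1) * Ring.inverse (g x) := by
  rcases U.eq_empty_or_nonempty with rfl | hne
  · exact ⟨0, by simp, by simp, by simp⟩
  have hd : ∀ x ∈ U, DifferentiableAt ℝ ω x := fun x hx =>
    (hω.contDiffAt (hU.mem_nhds hx)).differentiableAt (by simp)
  have hd' : ∀ x ∈ U, DifferentiableAt ℝ ω' x := fun x hx =>
    (hω'.contDiffAt (hU.mem_nhds hx)).differentiableAt (by simp)
  obtain ⟨g, hg0, hg⟩ := exists_parallel_section hU hne hstar
    (contDiffOn_gaugeConnection hω hω') (isFlatOn_gaugeConnection hd hd' hMC hMC') 1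
  obtain ⟨k, hk0, hk⟩ := exists_parallel_section hU hne hstar
    (contDiffOn_gaugeConnection hω' hω) (isFlatOn_gaugeConnection hd' hd hMC' hMC) 1
  have hgk : Set.EqOn (g * k) 1 U := eqOn_of_parallel hstar hU
    (contDiffOn_gaugeConnection hω' hω').continuousOn
    (fun x hx => (hg x hx).mul_parallel (hk x hx)) (fun x _ => hasFDerivAt_one_parallel _ x)
    (by simp [hg0, hk0])
  have hkg : Set.EqOn (k * g) 1 U := eqOn_of_parallel hstar hU
    (contDiffOn_gaugeConnection hω hω).continuousOn
    (fun x hx => (hk x hx).mul_parallel (hg x hx)) (fun x _ => hasFDerivAt_one_parallel _ x)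
    (by simp [hg0, hk0])
  refine ⟨g, contDiffOn_of_parallel hU (contDiffOn_gaugeConnection hω hω') hg,
    fun x hx => ⟨⟨g x, k x, hgk hx, hkg hx⟩, rfl⟩, fun i x hx => ?_⟩
  have hinv : Ring.inverse (g x) = k x := Ring.inverse_unit ⟨g x, k x, hgk hx, hkg hx⟩
  have hmul : g x * k x = 1 := hgk hx
  rw [hinv, (hg x hx).fderiv, ContinuousLinearMap.flip_apply, gaugeConnection_single, sub_mul,
    sub_sub_cancel, mul_assoc, hmul, mul_one]
end

section
/- (Smooth dependence of the multiplicative integral on parameters.) Let A be a real unital Banach algebra, E a finite-dimensional real normed vector space, and ω₁ : E × ℝ → A a smooth map. Then there exists a unique map g : E × ℝ → A such that g(x,0) = 1 and ∂_t g(x,t) = −ω₁(x,t)·g(x,t) for all (x,t); moreover g is smooth as a map on E × ℝ and g(x,t) is invertible for every (x,t). -/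
open Set unitInterval

section Curry

variable {P W A K : Type*} [NormedAddCommGroup P] [NormedAddCommGroup W] [NormedAddCommGroup A]
  [TopologicalSpace K]

/-- The partial map `p ↦ F (p, ι ·)` of a continuous map `F`, valued in continuous functions. -/
def curryComp (ι : C(K, W)) (F : P × W → A) (hF : Continuous F) : C(P, C(K, A)) :=
  ContinuousMap.curry ⟨fun q : P × K => F (q.1, ι q.2), by fun_prop⟩

@[simp]
lemma curryComp_apply (ι : C(K, W)) (F : P × W → A) (hF : Continuous F) (p : P) (s : K) :
    curryComp ι F hF p s = F (p, ι s) := rfl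

variable [NormedSpace ℝ P] [NormedSpace ℝ W] [NormedSpace ℝ A]

lemma continuous_fderiv_apply_inl {F : P × W → A} (hF : ContDiff ℝ 1 F) (y : P) :
    Continuous fun q => fderiv ℝ F q (y, 0) :=
  (hF.continuous_fderiv one_ne_zero).clm_apply continuous_const

variable [FiniteDimensional ℝ P] [CompactSpace K]

/-- The derivative of `curryComp` is computed pointwise. -/
lemma hasFDerivAt_curryComp (ι : C(K, W)) {F : P × W → A} (hF : ContDiff ℝ 1 F) (p : P) :
    ∃ L : P →L[ℝ] C(K, A),
      (∀ y, L y = curryComp ι _ (continuous_fderiv_apply_inl hF y) p) ∧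
      HasFDerivAt (curryComp ι F hF.continuous) L p := by
  let L : P →ₗ[ℝ] C(K, A) :=
    { toFun := fun y => curryComp ι _ (continuous_fderiv_apply_inl hF y) p
      map_add' := fun y z => by
        ext s
        simp only [curryComp_apply, ContinuousMap.add_apply, ← map_add, Prod.mk_add_mk, add_zero]
      map_smul' := fun c y => by
        ext s
        simp only [curryComp_apply, ContinuousMap.smul_apply, RingHom.id_apply, ← map_smul,
          Prod.smul_mk, smul_zero] }
  refine ⟨LinearMap.toContinuousLinearMap L, fun y => rfl, ?_⟩
  let D : P × W → P →L[ℝ] A := fun q => (fderiv ℝ F q).comp (ContinuousLinearMap.inl ℝ P W)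
  have hD : Continuous D :=
    (hF.continuous_fderiv one_ne_zero).clm_comp continuous_const
  rw [hasFDerivAt_iff_isLittleO, Asymptotics.isLittleO_iff]
  intro ε hε
  obtain ⟨δ, hδ, hball⟩ := Metric.continuousAt_iff.1
    ((curryComp ι D hD).continuous.continuousAt (x := p)) ε hε
  filter_upwards [Metric.ball_mem_nhds p hδ] with p' hp'
  rw [ContinuousMap.norm_le _ (by positivity)]
  intro s
  refine Convex.norm_image_sub_le_of_norm_hasFDerivWithin_le' (𝕜 := ℝ)
    (f := fun x => F (x, ι s)) (f' := fun x => D (x, ι s)) (φ := D (p, ι s))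
    (fun x _ => ?_) (fun x hx => ?_) (convex_ball p δ) (Metric.mem_ball_self hδ) hp'
  · have h1 : HasFDerivAt F (fderiv ℝ F (x, ι s)) (x, ι s) :=
      (hF.differentiable one_ne_zero _).hasFDerivAt
    exact (h1.comp x (hasFDerivAt_prodMk_left x (ι s))).hasFDerivWithinAt
  · have h2 := (hball hx).le
    rw [dist_eq_norm, ContinuousMap.norm_le _ hε.le] at h2
    exact h2 s

lemma contDiff_curryComp_nat (ι : C(K, W)) (n : ℕ) {F : P × W → A} (hF : ContDiff ℝ n F) :
    ContDiff ℝ n (curryComp ι F hF.continuous) := by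
  induction n generalizing F with
  | zero => exact contDiff_zero.2 (ContinuousMap.continuous _)
  | succ n ih =>
    have hF1 : ContDiff ℝ 1 F := hF.of_le (by norm_cast; omega)
    push_cast at hF ⊢
    rw [contDiff_succ_iff_fderiv_apply]
    refine ⟨fun p => ?_, fun h => absurd h (by simp), fun y => ?_⟩
    · obtain ⟨L, -, hL⟩ := hasFDerivAt_curryComp ι hF1 p
      exact hL.differentiableAt
    · have hG : ContDiff ℝ n fun q => fderiv ℝ F q (y, 0) :=
        (hF.fderiv_right le_rfl).clm_apply contDiff_const
      convert ih hG using 2 with p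
      obtain ⟨L, hLy, hL⟩ := hasFDerivAt_curryComp ι hF1 p
      rw [hL.fderiv, hLy]

lemma contDiff_curryComp (ι : C(K, W)) {F : P × W → A} (hF : ContDiff ℝ (⊤ : ℕ∞) F) :
    ContDiff ℝ (⊤ : ℕ∞) (curryComp ι F hF.continuous) :=
  contDiff_iff_forall_nat_le.2 fun n hn =>
    contDiff_curryComp_nat ι n (hF.of_le (by exact_mod_cast hn))

end Curry

section Volterra

lemma isUnit_one_sub_of_norm_pow_lt_one {R : Type*} [NormedRing R] [HasSummableGeomSeries R]
    {x : R} {n : ℕ} (hx : ‖x ^ n‖ < 1) : IsUnit (1 - x) := by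
  have h : IsUnit ((1 - x) * ∑ i ∈ Finset.range n, x ^ i) := by
    rw [mul_neg_geom_sum]
    exact isUnit_one_sub_of_norm_lt_one hx
  have hc : Commute (1 - x) (∑ i ∈ Finset.range n, x ^ i) := by
    rw [Commute, SemiconjBy, mul_neg_geom_sum, geom_sum_mul_neg]
  exact (hc.isUnit_mul_iff.1 h).1

variable {A : Type*} [NormedRing A] [NormedAlgebra ℝ A]

/-- Integration from `0`, as an operator on continuous functions on the unit interval. -/
noncomputable def primitiveCLM : C(I, A) →L[ℝ] C(I, A) :=
  LinearMap.mkContinuous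
    { toFun := fun u => ⟨fun s => ∫ r in (0 : ℝ)..s, IccExtend zero_le_one u r,
        (intervalIntegral.continuous_primitive
          (fun a b => (u.continuous.Icc_extend' (h := zero_le_one)).intervalIntegrable a b)
          0).comp continuous_subtype_val⟩
      map_add' := fun u v => by
        ext s
        exact intervalIntegral.integral_add
          ((u.continuous.Icc_extend' (h := zero_le_one)).intervalIntegrable _ _)
          ((v.continuous.Icc_extend' (h := zero_le_one)).intervalIntegrable _ _)
      map_smul' := fun c u => by
        ext s
        exact intervalIntegral.integral_smul c _ } 1 fun u => by
    rw [one_mul, ContinuousMap.norm_le _ (norm_nonneg u)]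
    intro s
    refine (intervalIntegral.norm_integral_le_of_norm_le_const (C := ‖u‖)
      fun r _ => u.norm_coe_le_norm _).trans ?_
    have h : |(s : ℝ) - 0| ≤ 1 := by
      rw [sub_zero, abs_of_nonneg s.2.1]
      exact s.2.2
    exact mul_le_of_le_one_right (norm_nonneg u) h

/-- The Volterra operator `u ↦ (s ↦ ∫ r in 0..s, a r * u r)`. -/
noncomputable def volterra (a : C(I, A)) : C(I, A) →L[ℝ] C(I, A) :=
  primitiveCLM.comp (ContinuousLinearMap.mul ℝ C(I, A) a)

lemma volterra_apply (a u : C(I, A)) (s : I) :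
    volterra a u s =
      ∫ r in (0 : ℝ)..s, IccExtend zero_le_one a r * IccExtend zero_le_one u r := rfl

lemma contDiff_volterra : ContDiff ℝ (⊤ : ℕ∞) (volterra (A := A)) :=
  contDiff_const.clm_comp (ContinuousLinearMap.contDiff _)

lemma norm_volterra_pow_apply_le (a u : C(I, A)) (n : ℕ) (s : I) :
    ‖(volterra a ^ n) u s‖ ≤ ‖a‖ ^ n * ‖u‖ * (s : ℝ) ^ n / n.factorial := by
  induction n generalizing s with
  | zero => simpa using u.norm_coe_le_norm s
  | succ n ih =>
    rw [pow_succ', mul_apply_eq_comp, volterra_apply]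
    have hint : ∫ r in (0 : ℝ)..s, ‖a‖ * (‖a‖ ^ n * ‖u‖ * r ^ n / n.factorial) =
        ‖a‖ ^ (n + 1) * ‖u‖ * (s : ℝ) ^ (n + 1) / (n + 1).factorial := by
      have h : ∀ r : ℝ, ‖a‖ * (‖a‖ ^ n * ‖u‖ * r ^ n / n.factorial) =
          (‖a‖ ^ (n + 1) * ‖u‖ / n.factorial) * r ^ n := fun r => by ring
      simp only [h]
      rw [intervalIntegral.integral_const_mul, integral_pow, Nat.factorial_succ]
      push_cast
      have : (n.factorial : ℝ) ≠ 0 := by positivity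
      field_simp
      simp
    rw [← hint]
    refine intervalIntegral.norm_integral_le_of_norm_le s.2.1 (.of_forall fun r hr => ?_)
      (Continuous.intervalIntegrable (by fun_prop) _ _)
    have hr' : r ∈ Icc (0 : ℝ) 1 := ⟨hr.1.le, hr.2.trans s.2.2⟩
    rw [IccExtend_of_mem _ _ hr', IccExtend_of_mem _ _ hr']
    exact (norm_mul_le _ _).trans
      (mul_le_mul (a.norm_coe_le_norm _) (ih _) (norm_nonneg _) (norm_nonneg _))

lemma norm_volterra_pow_le (a : C(I, A)) (n : ℕ) :
    ‖volterra a ^ n‖ ≤ ‖a‖ ^ n / n.factorial := by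
  refine ContinuousLinearMap.opNorm_le_bound _ (by positivity) fun u => ?_
  rw [ContinuousMap.norm_le _ (by positivity)]
  intro s
  refine (norm_volterra_pow_apply_le a u n s).trans ?_
  rw [div_mul_eq_mul_div]
  exact div_le_div_of_nonneg_right
    (mul_le_of_le_one_right (by positivity) (pow_le_one₀ s.2.1 s.2.2)) (by positivity)

lemma isUnit_one_sub_volterra [CompleteSpace A] (a : C(I, A)) : IsUnit (1 - volterra a) := by
  obtain ⟨n, hn⟩ := ((FloorSemiring.tendsto_pow_div_factorial_atTop ‖a‖).eventually_lt_const
    one_pos).exists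
  exact isUnit_one_sub_of_norm_pow_lt_one (R := C(I, A) →L[ℝ] C(I, A))
    ((norm_volterra_pow_le a n).trans_lt hn)

/-- The solution on the unit interval of `u' = a * u`, `u 0 = 1`. -/
noncomputable def volterraSol (a : C(I, A)) : C(I, A) := Ring.inverse (1 - volterra a) 1

lemma contDiff_volterraSol [CompleteSpace A] :
    ContDiff ℝ (⊤ : ℕ∞) (volterraSol : C(I, A) → C(I, A)) := by
  refine ContDiff.clm_apply (contDiff_iff_contDiffAt.2 fun a => ?_) contDiff_const
  obtain ⟨U, hU⟩ := isUnit_one_sub_volterra a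
  have h := contDiffAt_ringInverse ℝ (n := (⊤ : ℕ∞)) (R := C(I, A) →L[ℝ] C(I, A)) U
  rw [hU] at h
  have hf : ContDiff ℝ (⊤ : ℕ∞) fun b : C(I, A) => 1 - volterra b :=
    contDiff_const.sub contDiff_volterra
  exact h.comp a hf.contDiffAt

lemma eq_volterraSol_iff [CompleteSpace A] (a u : C(I, A)) :
    u = volterraSol a ↔ ∀ s : I, u s = 1 +
      ∫ r in (0 : ℝ)..s, IccExtend zero_le_one a r * IccExtend zero_le_one u r := by
  have hU := isUnit_one_sub_volterra a
  have h1 : u = volterraSol a ↔ (1 - volterra a) u = 1 := by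
    constructor
    · rintro rfl
      rw [volterraSol, ← mul_apply_eq_comp, Ring.mul_inverse_cancel _ hU,
        one_apply_eq_self]
    · intro h
      rw [volterraSol, ← h, ← mul_apply_eq_comp, Ring.inverse_mul_cancel _ hU,
        one_apply_eq_self]
  rw [h1, ContinuousMap.ext_iff]
  refine forall_congr' fun s => ?_
  rw [sub_apply, ContinuousMap.sub_apply, one_apply_eq_self,
    ContinuousMap.one_apply, volterra_apply, sub_eq_iff_eq_add]

end Volterra

section LinearODE

variable {A : Type*} [NormedRing A] [NormedAlgebra ℝ A]

/-- Solutions of the linear equation `y' = a * y` are determined by their value at `0`. -/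
lemma eq_of_hasDerivAt_mul {a y z : ℝ → A} (ha : Continuous a)
    (hy : ∀ t, HasDerivAt y (a t * y t) t) (hz : ∀ t, HasDerivAt z (a t * z t) t)
    (h0 : y 0 = z 0) : y = z := by
  funext t
  have habs : 0 ≤ |t| := abs_nonneg t
  obtain ⟨C, hC⟩ := (isCompact_Icc (a := -(|t| + 1)) (b := |t| + 1)).exists_bound_of_continuousOn
    ha.continuousOn
  refine ODE_solution_unique_of_mem_Ioo (v := fun t y => a t * y) (s := fun _ => univ)
    (K := C.toNNReal) (a := -(|t| + 1)) (b := |t| + 1) (t₀ := 0) (fun r hr => ?_)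
    ⟨by linarith, by linarith⟩ (fun r _ => ⟨hy r, mem_univ _⟩) (fun r _ => ⟨hz r, mem_univ _⟩) h0
    ⟨by linarith [neg_abs_le t], by linarith [le_abs_self t]⟩
  refine LipschitzWith.lipschitzOnWith (LipschitzWith.of_dist_le_mul fun u v => ?_)
  rw [dist_eq_norm, dist_eq_norm, ← mul_sub]
  exact (norm_mul_le _ _).trans (mul_le_mul_of_nonneg_right
    ((hC r (Ioo_subset_Icc_self hr)).trans (Real.le_coe_toNNReal C)) (norm_nonneg _))

/-- Running the equation backwards from time `t` gives a left inverse of the solution at `t`. -/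
lemma mul_eq_one_of_hasDerivAt {a y z : ℝ → A} (ha : Continuous a) {t : ℝ}
    (hy : ∀ s, HasDerivAt y (a s * y s) s) (hy0 : y 0 = 1)
    (hz : ∀ s, HasDerivAt z (a (t + s) * z s) s) (hz0 : z 0 = 1) :
    z (-t) * y t = 1 := by
  have h := eq_of_hasDerivAt_mul (a := fun s => a (t + s)) (y := fun s => z s * y t)
    (z := fun s => y (t + s)) (by fun_prop)
    (fun s => by simpa only [mul_assoc] using (hz s).mul_const (y t))
    (fun s => (hy (t + s)).comp_const_add t s) (by simp [hz0])
  simpa [hy0] using congrFun h (-t)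

end LinearODE

section Fundamental

variable {A E : Type*} [NormedRing A] [NormedAlgebra ℝ A] [NormedAddCommGroup E] [NormedSpace ℝ E]

lemma contDiff_rescale {ω : E × ℝ → A} (hω : ContDiff ℝ (⊤ : ℕ∞) ω) :
    ContDiff ℝ (⊤ : ℕ∞) fun q : (E × ℝ) × ℝ => q.1.2 • ω (q.1.1, q.1.2 * q.2) := by
  fun_prop

/-- The solution of `u' = t * ω (x, t * ·) * u`, `u 0 = 1`, on the unit interval. -/
noncomputable def rescaledSol (ω : E × ℝ → A) (hω : ContDiff ℝ (⊤ : ℕ∞) ω) (p : E × ℝ) : C(I, A) :=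
  volterraSol (curryComp ⟨Subtype.val, continuous_subtype_val⟩ _ (contDiff_rescale hω).continuous p)

variable [CompleteSpace A]

lemma rescaledSol_apply {ω : E × ℝ → A} (hω : ContDiff ℝ (⊤ : ℕ∞) ω) (p : E × ℝ) (s : I) :
    rescaledSol ω hω p s = 1 + ∫ r in (0 : ℝ)..s,
      (p.2 • ω (p.1, p.2 * r)) * IccExtend zero_le_one (rescaledSol ω hω p) r := by
  rw [(eq_volterraSol_iff _ _).1 (rfl : rescaledSol ω hω p = _) s]
  congr 1
  refine intervalIntegral.integral_congr fun r hr => ?_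
  rw [uIcc_of_le s.2.1] at hr
  simp only [IccExtend_of_mem _ _ (⟨hr.1, hr.2.trans s.2.2⟩ : r ∈ Icc (0 : ℝ) 1)]
  rfl

lemma rescaledSol_mul {ω : E × ℝ → A} (hω : ContDiff ℝ (⊤ : ℕ∞) ω) (x : E) (t : ℝ) (s r : I) :
    rescaledSol ω hω (x, t * s) r = rescaledSol ω hω (x, t) (s * r) := by
  suffices h : (rescaledSol ω hω (x, t)).comp ⟨fun r : I => s * r, by fun_prop⟩ =
      rescaledSol ω hω (x, t * s) from (DFunLike.congr_fun h r).symm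
  refine (eq_volterraSol_iff _ _).2 fun r => ?_
  change rescaledSol ω hω (x, t) (s * r) = _
  rw [rescaledSol_apply, Icc.coe_mul]
  congr 1
  have h := intervalIntegral.smul_integral_comp_mul_left (a := 0) (b := r) (fun r =>
    (t • ω (x, t * r)) * IccExtend zero_le_one (rescaledSol ω hω (x, t)) r) s
  rw [mul_zero] at h
  rw [← h, ← intervalIntegral.integral_smul]
  refine intervalIntegral.integral_congr fun v hv => ?_
  rw [uIcc_of_le r.2.1] at hv
  have hv' : v ∈ Icc (0 : ℝ) 1 := ⟨hv.1, hv.2.trans r.2.2⟩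
  have hsv : (s : ℝ) * v ∈ Icc (0 : ℝ) 1 := (s * ⟨v, hv'⟩ : I).2
  simp only [IccExtend_of_mem _ _ hv', IccExtend_of_mem _ _ hsv, curryComp_apply,
    ContinuousMap.coe_mk, ContinuousMap.comp_apply]
  rw [← smul_mul_assoc, smul_smul, mul_comm (s : ℝ) t, mul_assoc t]
  rfl

lemma hasDerivAt_rescaledSol_of_ne_zero {ω : E × ℝ → A} (hω : ContDiff ℝ (⊤ : ℕ∞) ω) (x : E)
    {t : ℝ} (ht : t ≠ 0) :
    HasDerivAt (fun s => rescaledSol ω hω (x, s) 1)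
      (ω (x, t) * rescaledSol ω hω (x, t) 1) t := by
  have hscale (s : I) : rescaledSol ω hω (x, 2 * t * s) 1 = rescaledSol ω hω (x, 2 * t) s := by
    rw [rescaledSol_mul, mul_one]
  have hmem : (2 * t)⁻¹ * t ∈ Ioo (0 : ℝ) 1 := by
    have : (2 * t)⁻¹ * t = 1 / 2 := by field_simp
    rw [this]
    norm_num
  let f : ℝ → A := fun r =>
    ((2 * t) • ω (x, 2 * t * r)) * IccExtend zero_le_one (rescaledSol ω hω (x, 2 * t)) r
  have hf : Continuous f :=
    ((hω.continuous.comp (by fun_prop : Continuous fun r : ℝ => (x, 2 * t * r))).const_smul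
      (2 * t)).mul (rescaledSol ω hω (x, 2 * t)).continuous.Icc_extend'
  have hprim : HasDerivAt (fun v => 1 + ∫ r in (0 : ℝ)..v, f r) (f ((2 * t)⁻¹ * t))
      ((2 * t)⁻¹ * t) := (hf.integral_hasStrictDerivAt 0 _).hasDerivAt.const_add 1
  have hcomp := hprim.scomp t ((hasDerivAt_id t).const_mul (2 * t)⁻¹)
  have hval (s : ℝ) (hs : (2 * t)⁻¹ * s ∈ Icc (0 : ℝ) 1) :
      rescaledSol ω hω (x, s) 1 = rescaledSol ω hω (x, 2 * t) ⟨(2 * t)⁻¹ * s, hs⟩ := by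
    rw [← hscale]
    congr 3
    field_simp
  refine (hcomp.congr_of_eventuallyEq ?_).congr_deriv ?_
  · have hcont : ContinuousAt (fun s : ℝ => (2 * t)⁻¹ * s) t := by fun_prop
    filter_upwards [hcont.eventually (isOpen_Ioo.mem_nhds hmem)] with s hs
    rw [hval s (Ioo_subset_Icc_self hs), rescaledSol_apply]
    rfl
  · have h2 : (2 * t)⁻¹ * (2 * t) = 1 := by field_simp
    have h3 : 2 * t * ((2 * t)⁻¹ * t) = t := by field_simp
    simp only [f]
    rw [hval t (Ioo_subset_Icc_self hmem), IccExtend_of_mem _ _ (Ioo_subset_Icc_self hmem), h3,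
      mul_one, ← smul_mul_assoc, smul_smul, h2, one_smul]

variable [FiniteDimensional ℝ E]

lemma contDiff_rescaledSol {ω : E × ℝ → A} (hω : ContDiff ℝ (⊤ : ℕ∞) ω) :
    ContDiff ℝ (⊤ : ℕ∞) (rescaledSol ω hω) :=
  contDiff_volterraSol.comp (contDiff_curryComp _ (contDiff_rescale hω))

/-- The equation `∂ₜ g = ω * g`, `g (x, 0) = 1` has a smooth global solution. -/
lemma exists_contDiff_hasDerivAt_mul {ω : E × ℝ → A} (hω : ContDiff ℝ (⊤ : ℕ∞) ω) :
    ∃ g : E × ℝ → A, ContDiff ℝ (⊤ : ℕ∞) g ∧ (∀ x, g (x, 0) = 1) ∧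
      ∀ x t, HasDerivAt (fun s => g (x, s)) (ω (x, t) * g (x, t)) t := by
  have hg : ContDiff ℝ (⊤ : ℕ∞) fun p => rescaledSol ω hω p 1 :=
    (ContinuousMap.evalCLM ℝ (1 : I) : C(I, A) →L[ℝ] A).contDiff.comp (contDiff_rescaledSol hω)
  refine ⟨fun p => rescaledSol ω hω p 1, hg, fun x => ?_, fun x t => ?_⟩
  · simp [rescaledSol_apply]
  · have hgx : ContDiff ℝ (⊤ : ℕ∞) fun s => rescaledSol ω hω (x, s) 1 :=
      hg.comp (contDiff_prodMk_right x)
    have hderiv : deriv (fun s => rescaledSol ω hω (x, s) 1) =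
        fun s => ω (x, s) * rescaledSol ω hω (x, s) 1 :=
      Continuous.ext_on (dense_compl_singleton (0 : ℝ)) (hgx.continuous_deriv (by simp))
        ((hω.continuous.comp (by fun_prop)).mul hgx.continuous)
        fun s hs => (hasDerivAt_rescaledSol_of_ne_zero hω x hs).deriv
    rw [← congrFun hderiv t]
    exact (hgx.differentiable (by simp) t).hasDerivAt

lemma isUnit_of_hasDerivAt_mul {ω : E × ℝ → A} (hω : ContDiff ℝ (⊤ : ℕ∞) ω) {x : E} {y : ℝ → A}
    (hy : ∀ s, HasDerivAt y (ω (x, s) * y s) s) (hy0 : y 0 = 1) (t : ℝ) : IsUnit (y t) := by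
  have hshift (c : ℝ) : ContDiff ℝ (⊤ : ℕ∞) fun p : E × ℝ => ω (p.1, c + p.2) := by fun_prop
  have hcont (c : ℝ) : Continuous fun s => ω (x, c + s) :=
    hω.continuous.comp (by fun_prop)
  obtain ⟨z, -, hz0, hz⟩ := exists_contDiff_hasDerivAt_mul (hshift t)
  obtain ⟨w, -, hw0, hw⟩ := exists_contDiff_hasDerivAt_mul (hshift 0)
  have hzy : z (x, -t) * y t = 1 :=
    mul_eq_one_of_hasDerivAt (a := fun s => ω (x, s)) (z := fun s => z (x, s))
      (by simpa using hcont 0) hy hy0 (hz x) (hz0 x)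
  have hwz : w (x, - -t) * z (x, -t) = 1 :=
    mul_eq_one_of_hasDerivAt (y := fun s => z (x, s)) (z := fun s => w (x, s)) (hcont t)
      (hz x) (hz0 x) (by simpa using hw x) (hw0 x)
  have hyz : y t * z (x, -t) = 1 := by
    rwa [left_inv_eq_right_inv hwz hzy] at hwz
  exact ⟨⟨y t, z (x, -t), hyz, hzy⟩, rfl⟩

end Fundamental

/-- **Smooth dependence of the multiplicative integral on parameters.**  For a smooth
`ω₁ : E × ℝ → A` (`E` finite-dimensional), there is a unique `g : E × ℝ → A` with
`g (x, 0) = 1` and `∂_t g (x, t) = -(ω₁ (x, t)) * g (x, t)`; moreover `g` is smooth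
on `E × ℝ` and every value `g (x, t)` is invertible. -/
theorem multiplicative_integral_smooth_in_parameters
    {A : Type*} [NormedRing A] [NormedAlgebra ℝ A] [CompleteSpace A]
    {E : Type*} [NormedAddCommGroup E] [NormedSpace ℝ E] [FiniteDimensional ℝ E]
    (ω₁ : E × ℝ → A) (hω₁ : ContDiff ℝ (⊤ : ℕ∞) ω₁) :
    ∃ g : E × ℝ → A,
      ((∀ x : E, g (x, 0) = 1) ∧
        ∀ (x : E) (t : ℝ),
          HasDerivAt (fun s => g (x, s)) (-(ω₁ (x, t)) * g (x, t)) t) ∧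
      ContDiff ℝ (⊤ : ℕ∞) g ∧
      (∀ p : E × ℝ, IsUnit (g p)) ∧
      ∀ g' : E × ℝ → A,
        ((∀ x : E, g' (x, 0) = 1) ∧
          ∀ (x : E) (t : ℝ),
            HasDerivAt (fun s => g' (x, s)) (-(ω₁ (x, t)) * g' (x, t)) t) → g' = g := by
  have hω : ContDiff ℝ (⊤ : ℕ∞) fun p => -(ω₁ p) := hω₁.neg
  obtain ⟨g, hg, hg0, hderiv⟩ := exists_contDiff_hasDerivAt_mul hω
  refine ⟨g, ⟨hg0, hderiv⟩, hg,
    fun p => isUnit_of_hasDerivAt_mul hω (hderiv p.1) (hg0 p.1) p.2, ?_⟩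
  rintro g' ⟨hg'0, hderiv'⟩
  funext ⟨x, t⟩
  exact congrFun (eq_of_hasDerivAt_mul (a := fun s => -(ω₁ (x, s)))
    (hω.continuous.comp (by fun_prop)) (hderiv' x) (hderiv x) ((hg'0 x).trans (hg0 x).symm)) t
end
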